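/- Let β_cr ∈ (π, 2π) be the critical angle for planar sectors, i.e. β_cr = sup{β ∈ [π, 2π] : H(Λ_β) = 1/4}. For every β ∈ [β_cr, 2π], the L² Hardy constant c_β = H(Λ_β) of the sector Λ_β = {(r cos θ, r sin θ) : r > 0, 0 < θ < β} is the unique solution c ∈ (0, 1/4] of the equation √c · tan(√c (β − π)/2) = 2 (Γ((3 + √(1 − 4c))/4) / Γ((1 + √(1 − 4c))/4))². -/

import Mathlib

open MeasureTheory Real

/-- The infinite planar sector of angle `β`. -/
def sector (β : ℝ) : Set (EuclideanSpace ℝ (Fin 2)) :=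
  {p | ∃ r θ : ℝ, 0 < r ∧ 0 < θ ∧ θ < β ∧ p 0 = r * Real.cos θ ∧ p 1 = r * Real.sin θ}

/-- The `L²` Hardy constant of an open set `Ω ⊆ ℝⁿ`: the supremum of constants `c ≥ 0`
such that `∫_Ω ‖∇u‖² ≥ c ∫_Ω u²/d²` for all `u ∈ C_c^∞(Ω)`, where `d(x) = dist(x, Ωᶜ)`. -/
noncomputable def hardyConst {n : ℕ} (Ω : Set (EuclideanSpace ℝ (Fin n))) : ℝ :=
  sSup {c : ℝ | 0 ≤ c ∧ ∀ u : EuclideanSpace ℝ (Fin n) → ℝ,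
    ContDiff ℝ (⊤ : ℕ∞) u → HasCompactSupport u → tsupport u ⊆ Ω →
    c * ∫ x in Ω, u x ^ 2 / Metric.infDist x Ωᶜ ^ 2 ≤ ∫ x in Ω, ‖gradient u x‖ ^ 2}

/-- The transcendental equation satisfied by the Hardy constant of a sector of angle `β`. -/
noncomputable def sectorEquation (β c : ℝ) : Prop :=
  Real.sqrt c * Real.tan (Real.sqrt c * (β - Real.pi) / 2)
    = 2 * (Real.Gamma ((3 + Real.sqrt (1 - 4 * c)) / 4)
        / Real.Gamma ((1 + Real.sqrt (1 - 4 * c)) / 4)) ^ 2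

lemma summable_coeff_mul_pow {a : ℕ → ℝ} {M : ℝ} {j : ℕ} (ha : ∀ n, |a n| ≤ M * (n + 1 : ℝ) ^ j)
    {x : ℝ} (hx : |x| < 1) : Summable fun n ↦ a n * x ^ n := by
  have h1 : Summable fun n : ℕ ↦ ((n + 1 : ℕ) : ℝ) ^ j * |x| ^ (n + 1) :=
    (summable_nat_add_iff (f := fun n : ℕ ↦ (n : ℝ) ^ j * |x| ^ n) 1).2
      (summable_pow_mul_geometric_of_norm_lt_one j (by simpa using hx))
  rcases eq_or_ne x 0 with rfl | h0
  · exact summable_of_ne_finset_zero (s := {0}) fun n hn ↦ by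
      simp at hn; simp [hn]
  refine Summable.of_norm_bounded ((h1.mul_left (M / |x|))) fun n ↦ ?_
  have : 0 < |x| := abs_pos.2 h0
  rw [norm_mul, norm_pow, Real.norm_eq_abs, Real.norm_eq_abs]
  calc |a n| * |x| ^ n ≤ (M * (n + 1 : ℝ) ^ j) * |x| ^ n := by gcongr; exact ha n
    _ = _ := by push_cast; rw [pow_succ]; field_simp

lemma hasDerivAt_tsum_coeff_mul_pow {a : ℕ → ℝ} {M : ℝ} {j : ℕ}
    (ha : ∀ n, |a n| ≤ M * (n + 1 : ℝ) ^ j) {x : ℝ} (hx : |x| < 1) :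
    HasDerivAt (fun y ↦ ∑' n, a n * y ^ n) (∑' n : ℕ, (n + 1) * a (n + 1) * x ^ n) x := by
  obtain ⟨r, hxr, hr1⟩ := exists_between hx
  have hr0 : 0 < r := (abs_nonneg x).trans_lt hxr
  have hM : 0 ≤ M := by have := (abs_nonneg _).trans (ha 0); simpa using this
  have hb : ∀ n : ℕ, |((n : ℝ)) * (M * (n + 1 : ℝ) ^ j)| ≤ M * (n + 1 : ℝ) ^ (j + 1) := by
    intro n
    rw [abs_of_nonneg (by positivity), pow_succ]
    nlinarith [show 0 ≤ M * (n + 1 : ℝ) ^ j by positivity]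
  have hs : Summable fun n : ℕ ↦ (n : ℝ) * (M * (n + 1 : ℝ) ^ j) * r ^ (n - 1) := by
    have := (summable_coeff_mul_pow hb (x := r) (by rwa [abs_of_pos hr0])).div_const r
    refine this.congr fun n ↦ ?_
    rcases n with _ | n
    · simp
    · simp [pow_succ]; field_simp
  have key := hasDerivAt_tsum_of_isPreconnected (𝕜 := ℝ) (g := fun n y ↦ a n * y ^ n)
    (g' := fun n y ↦ a n * (n * y ^ (n - 1))) (t := Set.Ioo (-r) r) (y₀ := 0) (y := x) hs isOpen_Ioo
    (convex_Ioo _ _).isPreconnected (fun n y _ ↦ by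
      simpa using (hasDerivAt_pow n y).const_mul (a n)) (fun n y hy ↦ by
      have hy' : |y| ≤ r := (abs_lt.2 hy).le
      rw [norm_mul, norm_mul, norm_pow, Real.norm_eq_abs, Real.norm_eq_abs, Real.norm_eq_abs,
        Nat.abs_cast]
      calc |a n| * (n * |y| ^ (n - 1)) ≤ (M * (n + 1 : ℝ) ^ j) * (n * r ^ (n - 1)) := by
            gcongr; exact ha n
        _ = _ := by ring) ⟨by linarith, hr0⟩
    (summable_coeff_mul_pow ha (by simp)) (abs_lt.1 hxr)
  have hs' : Summable fun n : ℕ ↦ a n * (n * x ^ (n - 1)) := by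
    refine Summable.of_norm_bounded hs fun n ↦ ?_
    rw [norm_mul, norm_mul, norm_pow, Real.norm_eq_abs, Real.norm_eq_abs, Real.norm_eq_abs,
        Nat.abs_cast]
    calc |a n| * (n * |x| ^ (n - 1)) ≤ (M * (n + 1 : ℝ) ^ j) * (n * r ^ (n - 1)) := by
            gcongr; exact ha n
        _ = _ := by ring
  have he : ∑' n : ℕ, a n * (n * x ^ (n - 1)) = ∑' n : ℕ, (n + 1) * a (n + 1) * x ^ n := by
    rw [hs'.tsum_eq_zero_add]
    simp only [Nat.cast_zero, zero_mul, mul_zero, zero_add, add_tsub_cancel_right]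
    exact tsum_congr fun n ↦ by push_cast; ring
  rwa [he] at key

/-- The even coefficients of the power series solutions of `(1 - x²) F'' - (1 + 2 α) x F' - α² F = 0`. -/
noncomputable def evenCoeff (α : ℝ) : ℕ → ℝ
  | 0 => 1
  | k + 1 => (2 * k + α) ^ 2 / ((2 * k + 1) * (2 * k + 2)) * evenCoeff α k

/-- The normalized odd coefficients of the same power series. -/
noncomputable def oddCoeff (α : ℝ) : ℕ → ℝ
  | 0 => 1
  | k + 1 => (2 * k + 1 + α) ^ 2 / ((2 * k + 2) * (2 * k + 3)) * oddCoeff α k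

/-- The coefficients of the power series with values `F 0 = 1` and `F' 0 = -ρ`. -/
noncomputable def gegenbauerCoeff (α ρ : ℝ) : ℕ → ℝ
  | 0 => 1
  | 1 => -ρ
  | n + 2 => (n + α) ^ 2 / ((n + 1) * (n + 2)) * gegenbauerCoeff α ρ n

/-- The limit of the ratios of even to odd coefficients: the largest slope `ρ` for which
`gegenbauerSum α ρ` stays positive on `[0, 1)`. -/
noncomputable def gammaSlope (α : ℝ) : ℝ := 2 * (Gamma ((α + 1) / 2) / Gamma (α / 2)) ^ 2

lemma gegenbauerCoeff_even (α ρ : ℝ) (k : ℕ) : gegenbauerCoeff α ρ (2 * k) = evenCoeff α k := by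
  induction k with
  | zero => simp [gegenbauerCoeff, evenCoeff]
  | succ k ih =>
    rw [show 2 * (k + 1) = 2 * k + 2 by ring, gegenbauerCoeff, evenCoeff, ih]; push_cast; rfl

lemma gegenbauerCoeff_odd (α ρ : ℝ) (k : ℕ) :
    gegenbauerCoeff α ρ (2 * k + 1) = -ρ * oddCoeff α k := by
  induction k with
  | zero => simp [gegenbauerCoeff, oddCoeff]
  | succ k ih =>
    rw [show 2 * (k + 1) + 1 = (2 * k + 1) + 2 by ring, gegenbauerCoeff, oddCoeff, ih]
    push_cast; ring_nf

lemma abs_gegenbauerCoeff_le {α : ℝ} (h0 : 0 ≤ α) (h1 : α ≤ 1) (ρ : ℝ) (n : ℕ) :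
    |gegenbauerCoeff α ρ n| ≤ max 1 |ρ| := by
  induction n using Nat.twoStepInduction with
  | zero => simp [gegenbauerCoeff]
  | one => simp [gegenbauerCoeff]
  | more n ih _ =>
    rw [gegenbauerCoeff, abs_mul]
    have : |((n : ℝ) + α) ^ 2 / ((n + 1) * (n + 2))| ≤ 1 := by
      rw [abs_of_nonneg (by positivity), div_le_one (by positivity)]
      have : (0:ℝ) ≤ n := n.cast_nonneg
      nlinarith
    calc _ ≤ 1 * max 1 |ρ| := by gcongr
      _ = _ := one_mul _

lemma evenCoeff_pos {α : ℝ} (h0 : 0 < α) (k : ℕ) : 0 < evenCoeff α k := by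
  induction k with
  | zero => simp [evenCoeff]
  | succ k ih => rw [evenCoeff]; positivity

lemma oddCoeff_pos {α : ℝ} (h0 : 0 < α) (k : ℕ) : 0 < oddCoeff α k := by
  induction k with
  | zero => simp [oddCoeff]
  | succ k ih => rw [oddCoeff]; positivity

lemma inv_le_oddCoeff {α : ℝ} (h0 : 1 / 2 ≤ α) (k : ℕ) : 1 / (2 * k + 1 : ℝ) ≤ oddCoeff α k := by
  induction k with
  | zero => simp [oddCoeff]
  | succ k ih =>
    rw [oddCoeff]
    have hk : (0:ℝ) ≤ k := k.cast_nonneg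
    calc (1 / (2 * ((k + 1 : ℕ) : ℝ) + 1) : ℝ) ≤
        (2 * k + 1 + α) ^ 2 / ((2 * k + 2) * (2 * k + 3)) * (1 / (2 * k + 1)) := by
          rw [div_mul_div_comm, div_le_div_iff₀ (by positivity) (by positivity)]
          push_cast
          have : (2 * k + 3 / 2 : ℝ) ^ 2 ≤ (2 * k + 1 + α) ^ 2 := by
            apply pow_le_pow_left₀ <;> linarith
          nlinarith
      _ ≤ _ := by gcongr

lemma evenCoeff_div_oddCoeff_succ_lt {α : ℝ} (h0 : 0 < α) (h1 : α ≤ 1) (k : ℕ) :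
    evenCoeff α (k + 1) / oddCoeff α (k + 1) < evenCoeff α k / oddCoeff α k := by
  have hA := evenCoeff_pos h0 k
  have hB := oddCoeff_pos h0 k
  rw [evenCoeff, oddCoeff, mul_div_mul_comm]
  refine mul_lt_of_lt_one_left (by positivity) ?_
  rw [div_div_div_eq, div_lt_one (by positivity)]
  have hk : (0:ℝ) ≤ k := k.cast_nonneg
  have : (2 * k + α) ^ 2 * (2 * k + 3) < (2 * k + 1) * (2 * k + 1 + α) ^ 2 := by
    nlinarith [mul_nonneg (by positivity : 0 ≤ 2 * k + α) (sub_nonneg.2 h1)]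
  nlinarith

lemma evenCoeff_div_oddCoeff_eq_prod {α : ℝ} (h0 : 0 < α) (n : ℕ) :
    evenCoeff α n / oddCoeff α n = (2 * n + 1) *
      ((∏ j ∈ Finset.range n, (α / 2 + j)) / ∏ j ∈ Finset.range n, ((α + 1) / 2 + j)) ^ 2 := by
  induction n with
  | zero => simp [evenCoeff, oddCoeff]
  | succ n ih =>
    rw [evenCoeff, oddCoeff, mul_div_mul_comm, ih, Finset.prod_range_succ, Finset.prod_range_succ]
    have : 0 < ∏ j ∈ Finset.range n, ((α + 1) / 2 + (j:ℝ)) := Finset.prod_pos fun j _ ↦ by positivity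
    push_cast
    field_simp
    ring

lemma tendsto_evenCoeff_div_oddCoeff {α : ℝ} (h0 : 0 < α) :
    Filter.Tendsto (fun k ↦ evenCoeff α k / oddCoeff α k) Filter.atTop (nhds (gammaSlope α)) := by
  rw [← Filter.tendsto_add_atTop_iff_nat 1]
  have h1 := Real.GammaSeq_tendsto_Gamma ((α + 1) / 2)
  have h2 := Real.GammaSeq_tendsto_Gamma (α / 2)
  have h3 := (h1.div h2 (Gamma_pos_of_pos (by positivity)).ne').pow 2
  have h4 : Filter.Tendsto (fun n : ℕ ↦ 2 + 3 * ((n : ℝ))⁻¹) Filter.atTop (nhds (2 + 3 * 0)) :=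
    (tendsto_inv_atTop_nhds_zero_nat.const_mul 3).const_add 2
  have h5 := h4.mul h3
  simp only [mul_zero, add_zero] at h5
  refine h5.congr' ?_
  filter_upwards [Filter.eventually_gt_atTop 0] with n hn
  rw [evenCoeff_div_oddCoeff_eq_prod h0]
  simp only [Pi.div_apply, Real.GammaSeq]
  have hn' : (0:ℝ) < n := by exact_mod_cast hn
  have p1 : 0 < ∏ j ∈ Finset.range (n + 1), ((α + 1) / 2 + (j:ℝ)) :=
    Finset.prod_pos fun j _ ↦ by positivity
  have p2 : 0 < ∏ j ∈ Finset.range (n + 1), (α / 2 + (j:ℝ)) :=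
    Finset.prod_pos fun j _ ↦ by positivity
  have e1 : (n : ℝ) ^ ((α + 1) / 2) = n ^ (α / 2) * √n := by
    rw [Real.sqrt_eq_rpow, ← Real.rpow_add hn']; congr 1; ring
  have e2 : √(n:ℝ) ^ 2 = n := Real.sq_sqrt hn'.le
  have e3 : 0 < (n : ℝ) ^ (α / 2) := by positivity
  rw [e1]
  push_cast
  generalize ∏ j ∈ Finset.range (n + 1), ((α + 1) / 2 + (j:ℝ)) = P at *
  generalize ∏ j ∈ Finset.range (n + 1), (α / 2 + (j:ℝ)) = Q at *
  have : (n.factorial : ℝ) ≠ 0 := by positivity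
  have : (n : ℝ) ^ (α / 2) * √n * n.factorial / P / (n ^ (α / 2) * n.factorial / Q) = √n * (Q / P) := by
    field_simp
  rw [this, mul_pow, e2]
  field_simp
  ring

lemma gammaSlope_le {α : ℝ} (h0 : 0 < α) (h1 : α ≤ 1) (k : ℕ) :
    gammaSlope α ≤ evenCoeff α k / oddCoeff α k :=
  (antitone_nat_of_succ_le fun n ↦ (evenCoeff_div_oddCoeff_succ_lt h0 h1 n).le).le_of_tendsto
    (tendsto_evenCoeff_div_oddCoeff h0) k

lemma gammaSlope_pos {α : ℝ} (h0 : 0 < α) : 0 < gammaSlope α := by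
  have := Gamma_pos_of_pos (show 0 < (α + 1) / 2 by positivity)
  have := Gamma_pos_of_pos (show 0 < α / 2 by positivity)
  unfold gammaSlope; positivity

lemma gammaSlope_lt_one {α : ℝ} (h0 : 0 < α) (h1 : α ≤ 1) : gammaSlope α < 1 := by
  refine (gammaSlope_le h0 h1 1).trans_lt ?_
  simpa [evenCoeff, oddCoeff] using evenCoeff_div_oddCoeff_succ_lt h0 h1 0

lemma gammaSlope_half_le : gammaSlope (1 / 2) ≤ 1 / 3 := by
  refine (gammaSlope_le (by norm_num) (by norm_num) 1).trans ?_
  norm_num [evenCoeff, oddCoeff]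

/-- The power series with coefficients `gegenbauerCoeff α ρ`. -/
noncomputable def gegenbauerSum (α ρ x : ℝ) : ℝ := ∑' n, gegenbauerCoeff α ρ n * x ^ n

lemma hasSum_gegenbauerSum_pairs {α : ℝ} (h0 : 0 < α) (h1 : α ≤ 1) (ρ : ℝ) {x : ℝ} (hx : |x| < 1) :
    HasSum (fun k ↦ evenCoeff α k * x ^ (2 * k) - ρ * oddCoeff α k * x ^ (2 * k + 1))
      (gegenbauerSum α ρ x) := by
  have hs : Summable fun n ↦ gegenbauerCoeff α ρ n * x ^ n :=
    summable_coeff_mul_pow (M := max 1 |ρ|) (j := 0)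
      (fun n ↦ by simpa using abs_gegenbauerCoeff_le h0.le h1 ρ n) hx
  have he : Summable fun k ↦ gegenbauerCoeff α ρ (2 * k) * x ^ (2 * k) :=
    hs.comp_injective (i := fun k ↦ 2 * k) fun a b h ↦ by simpa using h
  have ho : Summable fun k ↦ gegenbauerCoeff α ρ (2 * k + 1) * x ^ (2 * k + 1) :=
    hs.comp_injective (i := fun k ↦ 2 * k + 1) fun a b h ↦ by simpa using h
  have h := he.hasSum.add ho.hasSum
  have := (he.hasSum.even_add_odd (f := fun n ↦ gegenbauerCoeff α ρ n * x ^ n) ho.hasSum).tsum_eq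
  rw [← this] at h
  change HasSum _ (∑' n, gegenbauerCoeff α ρ n * x ^ n)
  convert h using 2 with k
  rw [gegenbauerCoeff_even, gegenbauerCoeff_odd]; ring

lemma gegenbauerSum_gammaSlope_pos {α : ℝ} (h0 : 0 < α) (h1 : α ≤ 1) {x : ℝ} (hx0 : 0 ≤ x)
    (hx : x < 1) : 0 < gegenbauerSum α (gammaSlope α) x := by
  have h := hasSum_gegenbauerSum_pairs h0 h1 (gammaSlope α) (x := x) (by rwa [abs_of_nonneg hx0])
  have hR := gammaSlope_pos h0
  have hle : ∀ k, 0 ≤ evenCoeff α k * x ^ (2 * k) -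
      gammaSlope α * oddCoeff α k * x ^ (2 * k + 1) := by
    intro k
    have hB := oddCoeff_pos h0 k
    have h2 := (le_div_iff₀ hB).1 (gammaSlope_le h0 h1 k)
    rw [pow_succ]
    have : 0 ≤ x ^ (2 * k) := by positivity
    have h3 : gammaSlope α * oddCoeff α k * (x ^ (2 * k) * x) ≤
      gammaSlope α * oddCoeff α k * (x ^ (2 * k) * 1) := by gcongr
    nlinarith
  have h4 := le_hasSum h 0 fun k _ ↦ hle k
  simp [evenCoeff, oddCoeff] at h4
  nlinarith [gammaSlope_lt_one h0 h1]

lemma exists_gegenbauerSum_neg {α ρ : ℝ} (h0 : 1 / 2 ≤ α) (h1 : α ≤ 1) (hρ : gammaSlope α < ρ) :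
    ∃ x₀ < 1, 0 ≤ x₀ ∧ ∀ x, x₀ ≤ x → x < 1 → gegenbauerSum α ρ x < 0 := by
  have hα : 0 < α := by linarith
  have hR := gammaSlope_pos hα
  obtain ⟨ρ', h2, h3⟩ := exists_between hρ
  obtain ⟨N, hN⟩ := Filter.eventually_atTop.1
    ((tendsto_evenCoeff_div_oddCoeff hα).eventually_lt_const h2)
  set δ := (ρ - ρ') / 2 with hδ
  have hδ0 : 0 < δ := by simp only [hδ]; linarith
  set C := ∑ k ∈ Finset.range N, evenCoeff α k with hC
  have hdiv : ¬ Summable fun k ↦ oddCoeff α k := by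
    intro hs
    have h4 : Summable fun k : ℕ ↦ 1 / 2 * (1 / ((k + 1 : ℕ) : ℝ)) := by
      refine Summable.of_nonneg_of_le (fun k ↦ by positivity) (fun k ↦ ?_) hs
      refine le_trans ?_ (inv_le_oddCoeff h0 k)
      push_cast
      rw [one_div_mul_one_div, one_div_le_one_div (by positivity) (by positivity)]
      linarith
    rw [summable_mul_left_iff (by norm_num)] at h4
    exact Real.not_summable_one_div_natCast ((summable_nat_add_iff 1).1 h4)
  have htop := (not_summable_iff_tendsto_nat_atTop_of_nonneg fun k ↦ (oddCoeff_pos hα k).le).1 hdiv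
  obtain ⟨M, hNM, hM⟩ := ((Filter.eventually_ge_atTop N).and (htop.eventually_gt_atTop
    (C / δ + ∑ k ∈ Finset.range N, oddCoeff α k))).exists
  rw [← Finset.sum_range_add_sum_Ico _ hNM] at hM
  have hP : C - δ * ∑ k ∈ Finset.Ico N M, oddCoeff α k * (1:ℝ) ^ (2 * k) < 0 := by
    have : C / δ < ∑ k ∈ Finset.Ico N M, oddCoeff α k := by linarith
    rw [div_lt_iff₀ hδ0] at this
    simp; linarith
  have hcont : Continuous fun x : ℝ ↦ C - δ * ∑ k ∈ Finset.Ico N M, oddCoeff α k * x ^ (2 * k) := by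
    fun_prop
  have hev1 := hcont.continuousAt.eventually_lt_const hP
  have hev2 : ∀ᶠ x in nhds (1:ℝ), ρ' + δ < ρ * x :=
    (continuous_const.mul continuous_id).continuousAt.eventually_const_lt (by simp [hδ]; linarith)
  obtain ⟨l, u, hu, hsub⟩ := mem_nhds_iff_exists_Ioo_subset.1 (hev1.and hev2)
  refine ⟨max 0 ((l + 1) / 2), max_lt one_pos (by linarith [hu.1]), le_max_left _ _, fun x hx hx1 ↦ ?_⟩
  have hx0 : 0 ≤ x := (le_max_left _ _).trans hx
  have hxl : l < x := by
    have := (le_max_right 0 ((l + 1) / 2)).trans hx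
    linarith [hu.1]
  obtain ⟨e1, e2⟩ := hsub ⟨hxl, hx1.trans hu.2⟩
  have h := hasSum_gegenbauerSum_pairs hα h1 ρ (x := x) (by rwa [abs_of_nonneg hx0])
  refine lt_of_le_of_lt ?_ e1
  have hterm : ∀ k, N ≤ k → evenCoeff α k * x ^ (2 * k) - ρ * oddCoeff α k * x ^ (2 * k + 1) ≤
      - δ * (oddCoeff α k * x ^ (2 * k)) := by
    intro k hk
    have hB := oddCoeff_pos hα k
    have h5 := (div_lt_iff₀ hB).1 (hN k hk)
    have h6 : 0 ≤ x ^ (2 * k) := by positivity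
    rw [pow_succ]
    have h7 : evenCoeff α k * x ^ (2 * k) ≤ ρ' * oddCoeff α k * x ^ (2 * k) := by gcongr
    have h8 : (ρ' + δ) * (oddCoeff α k * x ^ (2 * k)) ≤ ρ * x * (oddCoeff α k * x ^ (2 * k)) := by
      gcongr
    nlinarith
  have hneg : HasSum (fun k ↦ -(evenCoeff α k * x ^ (2 * k) - ρ * oddCoeff α k * x ^ (2 * k + 1)))
    (-gegenbauerSum α ρ x) := h.neg
  have h9 := sum_le_hasSum (Finset.range M) (fun k hk ↦ by
    have := hterm k (by simp at hk; omega)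
    have hB := oddCoeff_pos hα k
    have : 0 ≤ δ * (oddCoeff α k * x ^ (2 * k)) := by positivity
    linarith) hneg
  rw [← Finset.sum_range_add_sum_Ico _ hNM] at h9
  have h10 : -C ≤ ∑ k ∈ Finset.range N,
      -(evenCoeff α k * x ^ (2 * k) - ρ * oddCoeff α k * x ^ (2 * k + 1)) := by
    rw [hC, ← Finset.sum_neg_distrib]
    refine Finset.sum_le_sum fun k _ ↦ ?_
    have hA := evenCoeff_pos hα k
    have hB := oddCoeff_pos hα k
    have h11 : evenCoeff α k * x ^ (2 * k) ≤ evenCoeff α k * 1 := by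
      gcongr; exact pow_le_one₀ hx0 hx1.le
    have : 0 ≤ ρ * oddCoeff α k * x ^ (2 * k + 1) := by
      have : 0 < ρ := by linarith
      positivity
    linarith
  have h12 : δ * ∑ k ∈ Finset.Ico N M, oddCoeff α k * x ^ (2 * k) ≤ ∑ k ∈ Finset.Ico N M,
      -(evenCoeff α k * x ^ (2 * k) - ρ * oddCoeff α k * x ^ (2 * k + 1)) := by
    rw [Finset.mul_sum]
    refine Finset.sum_le_sum fun k hk ↦ ?_
    have := hterm k (Finset.mem_Ico.1 hk).1
    linarith
  linarith

lemma exists_gegenbauer_ode {α : ℝ} (h0 : 0 ≤ α) (h1 : α ≤ 1) (ρ : ℝ) :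
    ∃ f' f'' : ℝ → ℝ, (∀ x, |x| < 1 → HasDerivAt (gegenbauerSum α ρ) (f' x) x) ∧
      (∀ x, |x| < 1 → HasDerivAt f' (f'' x) x) ∧
      (∀ x, |x| < 1 → (1 - x ^ 2) * f'' x - (1 + 2 * α) * x * f' x - α ^ 2 * gegenbauerSum α ρ x = 0) ∧
      f' 0 = -ρ := by
  set a := gegenbauerCoeff α ρ with ha
  set M := max 1 |ρ| with hM
  have hM0 : 0 ≤ M := zero_le_one.trans (le_max_left _ _)
  have b0 : ∀ n, |a n| ≤ M * (n + 1 : ℝ) ^ 0 := fun n ↦ by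
    rw [pow_zero, mul_one]; exact abs_gegenbauerCoeff_le h0 h1 ρ n
  have b0' : ∀ n, |a n| ≤ M := fun n ↦ abs_gegenbauerCoeff_le h0 h1 ρ n
  have b1 : ∀ n : ℕ, |(n + 1 : ℝ) * a (n + 1)| ≤ M * (n + 1 : ℝ) ^ 1 := fun n ↦ by
    rw [abs_mul, abs_of_nonneg (by positivity), pow_one, mul_comm]
    gcongr; exact b0' _
  have b2 : ∀ n : ℕ, |(n + 1 : ℝ) * (((n + 1 : ℕ) + 1 : ℝ) * a (n + 1 + 1))| ≤
      (2 * M) * (n + 1 : ℝ) ^ 2 := fun n ↦ by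
    rw [abs_mul, abs_mul, abs_of_nonneg (by positivity), abs_of_nonneg (by positivity)]
    have := b0' (n + 1 + 1)
    push_cast
    have hn : (0:ℝ) ≤ n := n.cast_nonneg
    calc ((n:ℝ) + 1) * ((n + 1 + 1) * |a (n + 1 + 1)|) ≤ ((n:ℝ) + 1) * ((2 * (n + 1)) * M) := by
          gcongr; linarith
      _ = _ := by ring
  refine ⟨fun x ↦ ∑' n : ℕ, (n + 1) * a (n + 1) * x ^ n,
    fun x ↦ ∑' n : ℕ, (n + 1) * (((n + 1 : ℕ) + 1 : ℝ) * a (n + 1 + 1)) * x ^ n,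
    fun x hx ↦ hasDerivAt_tsum_coeff_mul_pow b0 hx,
    fun x hx ↦ hasDerivAt_tsum_coeff_mul_pow b1 hx, fun x hx ↦ ?_, ?_⟩
  · have s0 := (summable_coeff_mul_pow b0 hx).hasSum
    have s1 := (summable_coeff_mul_pow b1 hx).hasSum
    have s2 := (summable_coeff_mul_pow b2 hx).hasSum
    have t1 : HasSum (fun n : ℕ ↦ n * a n * x ^ n)
        (x * ∑' n : ℕ, (n + 1) * a (n + 1) * x ^ n) := by
      rw [← hasSum_nat_add_iff' 1]
      simp only [Finset.range_one, Finset.sum_singleton, Nat.cast_zero, zero_mul, sub_zero]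
      refine (congrArg (HasSum · _) (funext fun n ↦ ?_)).mp (s1.mul_left x)
      push_cast; ring
    have t2 : HasSum (fun n : ℕ ↦ n * (n - 1) * a n * x ^ n)
        (x ^ 2 * ∑' n : ℕ, (n + 1) * (((n + 1 : ℕ) + 1 : ℝ) * a (n + 1 + 1)) * x ^ n) := by
      rw [← hasSum_nat_add_iff' 2]
      simp only [Finset.sum_range_succ, Finset.range_zero, Finset.sum_empty, Nat.cast_zero,
        zero_mul, Nat.cast_one, sub_self, mul_zero, add_zero, sub_zero]
      refine (congrArg (HasSum · _) (funext fun n ↦ ?_)).mp (s2.mul_left (x ^ 2))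
      push_cast; ring
    have key := ((s2.sub t2).sub (t1.mul_left (1 + 2 * α))).sub (s0.mul_left (α ^ 2))
    have hterm : ∀ n : ℕ, (n + 1) * (((n + 1 : ℕ) + 1 : ℝ) * a (n + 1 + 1)) * x ^ n -
        n * (n - 1) * a n * x ^ n - (1 + 2 * α) * (n * a n * x ^ n) - α ^ 2 * (a n * x ^ n) = 0 := by
      intro n
      have : a (n + 1 + 1) = (n + α) ^ 2 / ((n + 1) * (n + 2)) * a n := by
        rw [ha, gegenbauerCoeff]
      rw [this]
      push_cast
      field_simp
      ring
    simp only [hterm] at key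
    have := key.unique hasSum_zero
    simp only [gegenbauerSum]
    rw [← ha]
    linarith
  · beta_reduce
    rw [tsum_eq_single 0 (fun n hn ↦ by simp [hn])]
    simp [ha, gegenbauerCoeff]

/-- Solutions of `ψ'' + α (1 - α) sin⁻² ψ = 0` on `(0, π)` with `ψ(π/2) = 1`, `ψ'(π/2) = ρ`. -/
lemma exists_angular_solution {α : ℝ} (h0 : 1 / 2 ≤ α) (h1 : α ≤ 1) (ρ : ℝ) :
    ∃ ψ ψ' : ℝ → ℝ, (∀ θ ∈ Set.Ioo 0 π, HasDerivAt ψ (ψ' θ) θ) ∧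
      (∀ θ ∈ Set.Ioo 0 π, HasDerivAt ψ' (-(α * (1 - α) / sin θ ^ 2 * ψ θ)) θ) ∧
      ψ (π / 2) = 1 ∧ ψ' (π / 2) = ρ ∧
      (ρ = gammaSlope α → ∀ θ ∈ Set.Ioc 0 (π / 2), 0 < ψ θ) ∧
      (gammaSlope α < ρ → ∃ ε > 0, ε < π / 2 ∧ ∀ θ ∈ Set.Ioc 0 ε, ψ θ < 0) := by
  have hα : 0 < α := by linarith
  obtain ⟨f', f'', hf, hf', hode, hf0⟩ := exists_gegenbauer_ode hα.le h1 ρ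
  set f := gegenbauerSum α ρ with hfdef
  have hcos : ∀ θ ∈ Set.Ioo 0 π, |cos θ| < 1 := fun θ hθ ↦ by
    have := sin_pos_of_pos_of_lt_pi hθ.1 hθ.2
    rw [← sq_lt_one_iff_abs_lt_one]; nlinarith [sin_sq_add_cos_sq θ]
  have hS : ∀ θ ∈ Set.Ioo 0 π, HasDerivAt (fun θ ↦ sin θ ^ α) (α * sin θ ^ α * cos θ / sin θ) θ := by
    intro θ hθ
    have hs := sin_pos_of_pos_of_lt_pi hθ.1 hθ.2
    convert (hasDerivAt_sin θ).rpow_const (p := α) (Or.inl hs.ne') using 1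
    rw [rpow_sub_one hs.ne']; ring
  refine ⟨fun θ ↦ sin θ ^ α * f (cos θ),
    fun θ ↦ sin θ ^ α * (α * cos θ / sin θ * f (cos θ) - sin θ * f' (cos θ)), ?_, ?_, ?_, ?_, ?_, ?_⟩
  · intro θ hθ
    have hs := sin_pos_of_pos_of_lt_pi hθ.1 hθ.2
    convert! (hS θ hθ).mul ((hf _ (hcos θ hθ)).comp θ (hasDerivAt_cos θ)) using 1
    simp; ring
  · intro θ hθ
    have hs := sin_pos_of_pos_of_lt_pi hθ.1 hθ.2
    have d1 := (hf _ (hcos θ hθ)).comp θ (hasDerivAt_cos θ)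
    have d2 := (hf' _ (hcos θ hθ)).comp θ (hasDerivAt_cos θ)
    have d3 := ((hasDerivAt_cos θ).const_mul α).div (hasDerivAt_sin θ) hs.ne'
    convert! (hS θ hθ).mul ((d3.mul d1).sub ((hasDerivAt_sin θ).mul d2)) using 1
    have e := hode _ (hcos θ hθ)
    have e2 : 1 - cos θ ^ 2 = sin θ ^ 2 := by rw [← sin_sq_add_cos_sq θ]; ring
    rw [e2] at e
    have e3 : f'' (cos θ) = ((1 + 2 * α) * cos θ * f' (cos θ) + α ^ 2 * f (cos θ)) / sin θ ^ 2 := by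
      rw [eq_div_iff (by positivity)]; linarith
    simp only [Function.comp_apply, Pi.mul_apply, Pi.div_apply, Pi.sub_apply]
    rw [e3]
    generalize sin θ ^ α = S
    field_simp
    have e4 : cos θ ^ 2 = 1 - sin θ ^ 2 := by linarith
    ring_nf
    rw [e4]
    ring
  · have := (hasSum_gegenbauerSum_pairs hα h1 ρ (x := 0) (by simp)).unique
      (hasSum_single 0 fun k hk ↦ by simp [hk])
    simp [hfdef, this, evenCoeff]
  · simp [hf0]
  · rintro rfl θ hθ
    have hs := sin_pos_of_pos_of_lt_pi hθ.1 (by linarith [hθ.2, pi_pos])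
    exact mul_pos (rpow_pos_of_pos hs _) (gegenbauerSum_gammaSlope_pos hα h1
      (cos_nonneg_of_mem_Icc ⟨by linarith [hθ.1, pi_pos], hθ.2⟩)
      (lt_of_abs_lt (hcos θ ⟨hθ.1, by linarith [hθ.2, pi_pos]⟩)))
  · intro hρ
    obtain ⟨x₀, hx1, hx0, hneg⟩ := exists_gegenbauerSum_neg h0 h1 hρ
    have hpi := pi_pos
    set x₁ := max x₀ (1 / 2) with hx₁
    have hx₁1 : x₁ < 1 := max_lt hx1 (by norm_num)
    have hx₁2 : 1 / 2 ≤ x₁ := le_max_right _ _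
    refine ⟨arccos x₁, arccos_pos.2 hx₁1, arccos_lt_pi_div_two.2 (by linarith), fun θ hθ ↦ ?_⟩
    have hlt : θ < π := hθ.2.trans_lt ((arccos_lt_pi_div_two.2 (by linarith)).trans (by linarith))
    have hs := sin_pos_of_pos_of_lt_pi hθ.1 hlt
    refine mul_neg_of_pos_of_neg (rpow_pos_of_pos hs _) (hneg _ ?_ ?_)
    · refine (le_max_left x₀ (1 / 2)).trans ?_
      rw [← hx₁, ← cos_arccos (x := x₁) (by linarith) hx₁1.le]
      exact cos_le_cos_of_nonneg_of_le_pi hθ.1.le (arccos_le_pi _) hθ.2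
    · exact lt_of_abs_lt (hcos θ ⟨hθ.1, hlt⟩)

/-- The distance to the boundary of the sector of angle `β ∈ [π, 2π]` from the point of the unit
circle with argument `θ`. -/
noncomputable def angularDist (β θ : ℝ) : ℝ :=
  if θ ≤ π / 2 then sin θ else if θ ≤ β - π / 2 then 1 else sin (β - θ)

lemma riccati_integral_le {p q : ℝ} (hpq : p ≤ q) {g V φ φ' : ℝ → ℝ}
    (hg : ∀ x ∈ Set.Icc p q, HasDerivAt g (-(g x ^ 2) - V x) x)
    (hV : ContinuousOn V (Set.Icc p q)) (hφ : ∀ x, HasDerivAt φ (φ' x) x) (hφ' : Continuous φ') :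
    g q * φ q ^ 2 - g p * φ p ^ 2 + ∫ x in p..q, V x * φ x ^ 2 ≤ ∫ x in p..q, φ' x ^ 2 := by
  have hφc : Continuous φ := continuous_iff_continuousAt.2 fun x ↦ (hφ x).continuousAt
  have hgc : ContinuousOn g (Set.Icc p q) := fun x hx ↦ (hg x hx).continuousAt.continuousWithinAt
  have hder : ∀ x ∈ Set.uIcc p q, HasDerivAt (fun x ↦ g x * φ x ^ 2)
      ((-(g x ^ 2) - V x) * φ x ^ 2 + g x * (2 * φ x * φ' x)) x := by
    intro x hx
    rw [Set.uIcc_of_le hpq] at hx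
    convert! (hg x hx).mul ((hφ x).pow 2) using 1
    simp
  have i1 : IntervalIntegrable (fun x ↦ (-(g x ^ 2) - V x) * φ x ^ 2 + g x * (2 * φ x * φ' x))
      volume p q := by
    apply ContinuousOn.intervalIntegrable
    rw [Set.uIcc_of_le hpq]
    fun_prop
  have i2 : IntervalIntegrable (fun x ↦ V x * φ x ^ 2) volume p q := by
    apply ContinuousOn.intervalIntegrable
    rw [Set.uIcc_of_le hpq]
    fun_prop
  have i3 : IntervalIntegrable (fun x ↦ φ' x ^ 2) volume p q := (hφ'.pow 2).intervalIntegrable _ _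
  rw [← intervalIntegral.integral_eq_sub_of_hasDerivAt hder i1, ← intervalIntegral.integral_add i1 i2]
  refine intervalIntegral.integral_mono_on hpq (i1.add i2) i3 fun x _ ↦ ?_
  nlinarith [sq_nonneg (φ' x - g x * φ x)]

lemma integral_left_eq {a : ℝ} (ha : 0 < a) (ha' : a ≤ π / 2) {φ : ℝ → ℝ} (hφ : Continuous φ)
    (h0 : ∀ θ ∈ Set.Icc 0 a, φ θ = 0) :
    IntervalIntegrable (fun θ ↦ φ θ ^ 2 / sin θ ^ 2) volume 0 (π / 2) ∧
    ∫ θ in 0..(π / 2), φ θ ^ 2 / sin θ ^ 2 = ∫ θ in a..(π / 2), φ θ ^ 2 / sin θ ^ 2 := by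
  have hz : Set.EqOn (fun θ ↦ φ θ ^ 2 / sin θ ^ 2) (fun _ ↦ 0) (Set.uIcc 0 a) := fun θ hθ ↦ by
    rw [Set.uIcc_of_le ha.le] at hθ
    simp [h0 θ hθ]
  have i1 : IntervalIntegrable (fun θ ↦ φ θ ^ 2 / sin θ ^ 2) volume 0 a :=
    (intervalIntegrable_const (c := (0:ℝ))).congr (fun θ hθ ↦
      (hz (Set.uIoc_subset_uIcc hθ)).symm)
  have i2 : IntervalIntegrable (fun θ ↦ φ θ ^ 2 / sin θ ^ 2) volume a (π / 2) := by
    apply ContinuousOn.intervalIntegrable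
    rw [Set.uIcc_of_le ha']
    refine ContinuousOn.div (by fun_prop) (by fun_prop) fun x hx ↦ ?_
    have := sin_pos_of_pos_of_lt_pi (ha.trans_le hx.1) (by linarith [hx.2, pi_pos])
    positivity
  refine ⟨i1.trans i2, ?_⟩
  rw [← intervalIntegral.integral_add_adjacent_intervals i1 i2, intervalIntegral.integral_congr hz]
  simp

lemma integral_div_angularDist {β a : ℝ} (hβ : π ≤ β) (ha : 0 < a) (ha' : a ≤ π / 2) {φ : ℝ → ℝ}
    (hφ : Continuous φ) (h0 : ∀ θ ∈ Set.Icc 0 a, φ θ = 0) (h1 : ∀ θ ∈ Set.Icc (β - a) β, φ θ = 0) :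
    ∫ θ in 0..β, φ θ ^ 2 / angularDist β θ ^ 2 =
      (∫ θ in 0..(π / 2), φ θ ^ 2 / sin θ ^ 2) + (∫ θ in (π / 2)..(β - π / 2), φ θ ^ 2) +
        ∫ θ in 0..(π / 2), φ (β - θ) ^ 2 / sin θ ^ 2 := by
  have hpi := pi_pos
  obtain ⟨i1, -⟩ := integral_left_eq ha ha' hφ h0
  obtain ⟨i3, -⟩ := integral_left_eq (φ := fun θ ↦ φ (β - θ)) ha ha' (by fun_prop)
    (fun θ hθ ↦ h1 _ ⟨by linarith [hθ.2], by linarith [hθ.1]⟩)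
  have i3' : IntervalIntegrable (fun θ ↦ φ θ ^ 2 / sin (β - θ) ^ 2) volume (β - π / 2) β := by
    simpa using (i3.comp_sub_left β).symm
  have i2 : IntervalIntegrable (fun θ ↦ φ θ ^ 2) volume (π / 2) (β - π / 2) :=
    (hφ.pow 2).intervalIntegrable _ _
  have e1 : Set.EqOn (fun θ ↦ φ θ ^ 2 / sin θ ^ 2) (fun θ ↦ φ θ ^ 2 / angularDist β θ ^ 2)
      (Set.uIcc 0 (π / 2)) := fun θ hθ ↦ by
    rw [Set.uIcc_of_le (by linarith)] at hθ
    simp [angularDist, hθ.2]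
  have e2 : Set.EqOn (fun θ ↦ φ θ ^ 2) (fun θ ↦ φ θ ^ 2 / angularDist β θ ^ 2)
      (Set.uIcc (π / 2) (β - π / 2)) := fun θ hθ ↦ by
    rw [Set.uIcc_of_le (by linarith)] at hθ
    rcases hθ.1.eq_or_lt with h | h
    · simp [angularDist, ← h]
    · simp [angularDist, not_le.2 h, hθ.2]
  have e3 : Set.EqOn (fun θ ↦ φ θ ^ 2 / sin (β - θ) ^ 2) (fun θ ↦ φ θ ^ 2 / angularDist β θ ^ 2)
      (Set.uIcc (β - π / 2) β) := fun θ hθ ↦ by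
    rw [Set.uIcc_of_le (by linarith)] at hθ
    rcases hθ.1.eq_or_lt with h | h
    · have : sin (β - θ) = 1 := by rw [← h]; simp
      beta_reduce
      rw [this]
      by_cases h' : θ ≤ π / 2
      · have : θ = π / 2 := by linarith
        simp [angularDist, this]
      · simp [angularDist, h', h.symm.le]
    · simp [angularDist, not_le.2 h, not_le.2 (show π / 2 < θ by linarith)]
  have hr : ∫ θ in 0..(π / 2), φ (β - θ) ^ 2 / sin θ ^ 2 =
      ∫ θ in (β - π / 2)..β, φ θ ^ 2 / sin (β - θ) ^ 2 := by
    have := intervalIntegral.integral_comp_sub_left (a := 0) (b := π / 2)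
      (fun θ ↦ φ θ ^ 2 / sin (β - θ) ^ 2) β
    simpa using this
  rw [hr, intervalIntegral.integral_congr e1, intervalIntegral.integral_congr e2,
    intervalIntegral.integral_congr e3]
  have j1 := i1.congr (fun θ hθ ↦ e1 (Set.uIoc_subset_uIcc hθ))
  have j2 := i2.congr (fun θ hθ ↦ e2 (Set.uIoc_subset_uIcc hθ))
  have j3 := i3'.congr (fun θ hθ ↦ e3 (Set.uIoc_subset_uIcc hθ))
  rw [intervalIntegral.integral_add_adjacent_intervals j1 j2,
    intervalIntegral.integral_add_adjacent_intervals (j1.trans j2) j3]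

lemma hardy_left {α : ℝ} (h0 : 1 / 2 ≤ α) (h1 : α ≤ 1) {a : ℝ} (ha : 0 < a) (ha' : a ≤ π / 2)
    {φ φ' : ℝ → ℝ} (hφ : ∀ x, HasDerivAt φ (φ' x) x) (hφ' : Continuous φ')
    (hz : ∀ θ ∈ Set.Icc 0 a, φ θ = 0) :
    gammaSlope α * φ (π / 2) ^ 2 + α * (1 - α) * (∫ θ in 0..(π / 2), φ θ ^ 2 / sin θ ^ 2) ≤
      ∫ θ in 0..(π / 2), φ' θ ^ 2 := by
  have hpi := pi_pos
  have hφc : Continuous φ := continuous_iff_continuousAt.2 fun x ↦ (hφ x).continuousAt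
  obtain ⟨ψ, ψ', d1, d2, v1, v2, hpos, -⟩ := exists_angular_solution h0 h1 (gammaSlope α)
  have hpos := hpos rfl
  rw [(integral_left_eq ha ha' hφc hz).2]
  have hs : ∀ x ∈ Set.Icc a (π / 2), 0 < sin x := fun x hx ↦
    sin_pos_of_pos_of_lt_pi (ha.trans_le hx.1) (by linarith [hx.2])
  have key := riccati_integral_le ha' (g := fun θ ↦ ψ' θ / ψ θ)
    (V := fun θ ↦ α * (1 - α) / sin θ ^ 2) (fun x hx ↦ by
      have hx' : x ∈ Set.Ioo 0 π := ⟨ha.trans_le hx.1, by linarith [hx.2]⟩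
      have hp := hpos x ⟨hx'.1, hx.2⟩
      have := hs x hx
      convert! (d2 x hx').div (d1 x hx') hp.ne' using 1
      field_simp
      ring) (ContinuousOn.div (by fun_prop) (by fun_prop) fun x hx ↦ by
        have := hs x hx
        positivity) hφ hφ'
  have hza : φ a = 0 := hz a ⟨ha.le, le_rfl⟩
  rw [hza, v1, v2] at key
  have e : ∫ x in a..(π / 2), α * (1 - α) / sin x ^ 2 * φ x ^ 2 =
      α * (1 - α) * ∫ x in a..(π / 2), φ x ^ 2 / sin x ^ 2 := by
    rw [← intervalIntegral.integral_const_mul]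
    congr 1; ext x; ring
  rw [e] at key
  have hc2 : Continuous fun θ ↦ φ' θ ^ 2 := hφ'.pow 2
  rw [← intervalIntegral.integral_add_adjacent_intervals (hc2.intervalIntegrable 0 a)
    (hc2.intervalIntegrable a (π / 2))]
  have : 0 ≤ ∫ θ in 0..a, φ' θ ^ 2 :=
    intervalIntegral.integral_nonneg ha.le fun x _ ↦ sq_nonneg _
  simp at key
  linarith

lemma hardy_angular {α β κ : ℝ} (h0 : 1 / 2 ≤ α) (h1 : α ≤ 1) (hβ : β ∈ Set.Icc π (2 * π))
    (hκ0 : 0 ≤ κ) (hκ1 : κ < 1) (hκ : κ ^ 2 = α * (1 - α))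
    (hR : κ * tan (κ * (β - π) / 2) = gammaSlope α) {a : ℝ} (ha : 0 < a) (ha' : a ≤ π / 2)
    {φ φ' : ℝ → ℝ} (hφ : ∀ x, HasDerivAt φ (φ' x) x) (hφ' : Continuous φ')
    (hz : ∀ θ ∈ Set.Icc 0 a, φ θ = 0) (hz' : ∀ θ ∈ Set.Icc (β - a) β, φ θ = 0) :
    κ ^ 2 * (∫ θ in 0..β, φ θ ^ 2 / angularDist β θ ^ 2) ≤ ∫ θ in 0..β, φ' θ ^ 2 := by
  have hpi := pi_pos
  obtain ⟨hβ1, hβ2⟩ := hβ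
  have hφc : Continuous φ := continuous_iff_continuousAt.2 fun x ↦ (hφ x).continuousAt
  rw [integral_div_angularDist hβ1 ha ha' hφc hz hz']
  have l1 := hardy_left h0 h1 ha ha' hφ hφ' hz
  have l3 := hardy_left h0 h1 ha ha' (φ := fun θ ↦ φ (β - θ)) (φ' := fun θ ↦ -φ' (β - θ))
    (fun x ↦ (hφ (β - x)).comp_const_sub β x) (by fun_prop)
    (fun θ hθ ↦ hz' _ ⟨by linarith [hθ.2], by linarith [hθ.1]⟩)
  have hr : ∫ θ in 0..(π / 2), (-φ' (β - θ)) ^ 2 = ∫ θ in (β - π / 2)..β, φ' θ ^ 2 := by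
    have := intervalIntegral.integral_comp_sub_left (a := 0) (b := π / 2)
      (fun θ ↦ φ' θ ^ 2) β
    simpa using this
  rw [hr] at l3
  have l2 := riccati_integral_le (p := π / 2) (q := β - π / 2) (by linarith)
    (g := fun θ ↦ -κ * tan (κ * (θ - β / 2))) (V := fun _ ↦ κ ^ 2) (fun x hx ↦ by
      have hc : 0 < cos (κ * (x - β / 2)) := by
        have : |κ * (x - β / 2)| < π / 2 := by
          rw [abs_mul, abs_of_nonneg hκ0]
          have : |x - β / 2| ≤ π / 2 := abs_le.2 ⟨by linarith [hx.1], by linarith [hx.2]⟩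
          have := abs_nonneg (x - β / 2)
          nlinarith
        exact cos_pos_of_mem_Ioo (abs_lt.1 this)
      have d := ((hasDerivAt_tan hc.ne').comp x
        (((hasDerivAt_id x).sub_const (β / 2)).const_mul κ)).const_mul (-κ)
      convert! d using 1
      simp only [mul_one]
      rw [← inv_eq_one_div, ← inv_one_add_tan_sq hc.ne', inv_inv]
      ring) (by fun_prop) hφ hφ'
  rw [intervalIntegral.integral_const_mul] at l2
  have t1 : -κ * tan (κ * (β - π / 2 - β / 2)) = -gammaSlope α := by
    rw [← hR]; ring_nf
  have t2 : -κ * tan (κ * (π / 2 - β / 2)) = gammaSlope α := by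
    rw [← hR, show κ * (π / 2 - β / 2) = -(κ * (β - π) / 2) by ring, tan_neg]; ring
  simp only [t1, t2] at l2
  have hc2 : Continuous fun θ ↦ φ' θ ^ 2 := hφ'.pow 2
  rw [← intervalIntegral.integral_add_adjacent_intervals (hc2.intervalIntegrable 0 (π / 2))
    (hc2.intervalIntegrable (π / 2) β), ← intervalIntegral.integral_add_adjacent_intervals
      (hc2.intervalIntegrable (π / 2) (β - π / 2)) (hc2.intervalIntegrable (β - π / 2) β)]
  rw [← hκ] at l1 l3
  linarith

lemma measurable_angularDist (β : ℝ) : Measurable (angularDist β) := by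
  unfold angularDist
  refine Measurable.ite measurableSet_Iic measurable_sin
    (Measurable.ite measurableSet_Iic measurable_const (by fun_prop))

lemma sin_le_angularDist {β a θ : ℝ} (ha : 0 < a) (ha' : a ≤ π / 2) (h1 : a ≤ θ) (h2 : θ ≤ β - a) :
    sin a ≤ angularDist β θ := by
  have hpi := pi_pos
  unfold angularDist
  split_ifs with h3 h4
  · exact sin_le_sin_of_le_of_le_pi_div_two (by linarith) h3 h1
  · exact sin_le_one _
  · exact sin_le_sin_of_le_of_le_pi_div_two (by linarith) (by linarith) (by linarith)

/-- An inequality for smooth functions extends to `C¹` functions. -/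
lemma angular_inequality_of_smooth {β a c : ℝ} (ha : 0 < a) (ha' : a ≤ π / 2)
    (hsmooth : ∀ φ : ℝ → ℝ, ContDiff ℝ (⊤ : ℕ∞) φ → (∀ θ, θ ≤ a → φ θ = 0) →
      (∀ θ, β - a ≤ θ → φ θ = 0) →
      c * (∫ θ in 0..β, φ θ ^ 2 / angularDist β θ ^ 2) ≤ ∫ θ in 0..β, deriv φ θ ^ 2)
    {φ φ' : ℝ → ℝ} (hφ : ∀ x, HasDerivAt φ (φ' x) x) (hφ' : Continuous φ')
    (h0 : ∀ θ, θ ≤ 2 * a → φ θ = 0) (h1 : ∀ θ, β - 2 * a ≤ θ → φ θ = 0) :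
    c * (∫ θ in 0..β, φ θ ^ 2 / angularDist β θ ^ 2) ≤ ∫ θ in 0..β, φ' θ ^ 2 := by
  have hφc : Continuous φ := continuous_iff_continuousAt.2 fun x ↦ (hφ x).continuousAt
  have hderiv : deriv φ = φ' := funext fun x ↦ (hφ x).deriv
  have hC1 : ContDiff ℝ 1 φ := contDiff_one_iff_deriv.2
    ⟨fun x ↦ (hφ x).differentiableAt, by rwa [hderiv]⟩
  have hcs : HasCompactSupport φ := by
    refine HasCompactSupport.intro (isCompact_Icc (a := 2 * a) (b := β - 2 * a)) fun x hx ↦ ?_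
    rcases not_and_or.1 hx with h | h
    · exact h0 x (by linarith [not_le.1 h])
    · exact h1 x (by linarith [not_le.1 h])
  have hcs' : HasCompactSupport φ' := hderiv ▸ hcs.deriv
  obtain ⟨C, hC⟩ := hφc.bounded_above_of_compact_support hcs
  obtain ⟨C', hC'⟩ := hφ'.bounded_above_of_compact_support hcs'
  let b : ℕ → ContDiffBump (0 : ℝ) := fun n ↦
    ⟨a / (n + 1) / 2, a / (n + 1), by positivity, half_lt_self (by positivity)⟩
  have hrle : ∀ n, (b n).rOut ≤ a := fun n ↦ by
    have : (0:ℝ) ≤ n := n.cast_nonneg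
    exact div_le_self ha.le (by linarith)
  have hr : Filter.Tendsto (fun n ↦ (b n).rOut) Filter.atTop (nhds 0) := by
    have := (tendsto_one_div_add_atTop_nhds_zero_nat (𝕜 := ℝ)).const_mul a
    simpa [b, div_eq_mul_inv] using this
  let Φ : ℕ → (ℝ → ℝ) → ℝ → ℝ := fun n f ↦
    convolution ((b n).normed volume) f (ContinuousLinearMap.lsmul ℝ ℝ) volume
  have hΦb : ∀ n (f : ℝ → ℝ) K, Continuous f → (∀ x, ‖f x‖ ≤ K) → ∀ x, |Φ n f x| ≤ 3 * K := by
    intro n f K hf hK x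
    have := (b n).dist_normed_convolution_le (μ := volume) (g := f) (x₀ := x) (ε := 2 * K)
      hf.aestronglyMeasurable (fun y _ ↦ by
        rw [Real.dist_eq]
        have := hK x
        have := hK y
        rw [Real.norm_eq_abs] at *
        exact (abs_sub _ _).trans (by linarith))
    rw [Real.dist_eq] at this
    have h3 := hK x
    rw [Real.norm_eq_abs] at h3
    have h4 := abs_sub_abs_le_abs_sub (Φ n f x) (f x)
    change |Φ n f x - f x| ≤ _ at this
    linarith
  have hΦt : ∀ (f : ℝ → ℝ), Continuous f → ∀ x,
      Filter.Tendsto (fun n ↦ Φ n f x) Filter.atTop (nhds (f x)) := fun f hf x ↦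
    ContDiffBump.convolution_tendsto_right_of_continuous hr hf x
  have hΦd : ∀ n x, HasDerivAt (Φ n φ) (Φ n φ' x) x := by
    intro n x
    have := hcs.hasDerivAt_convolution_right (ContinuousLinearMap.lsmul ℝ ℝ) (μ := volume)
      (f₀ := (b n).normed volume) ((b n).continuous_normed.locallyIntegrable) hC1 x
    rwa [hderiv] at this
  have hΦs : ∀ n, ContDiff ℝ (⊤ : ℕ∞) (Φ n φ) := fun n ↦
    (b n).hasCompactSupport_normed.contDiff_convolution_left _ (b n).contDiff_normed
      hφc.locallyIntegrable
  have hΦ0 : ∀ n θ, θ ≤ a → Φ n φ θ = 0 := by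
    intro n θ hθ
    have hθ0 := h0 θ (by linarith)
    rw [← hθ0]
    refine (b n).normed_convolution_eq_right fun x hx ↦ ?_
    rw [hθ0]
    rw [Metric.mem_ball, Real.dist_eq] at hx
    exact h0 x (by linarith [(abs_lt.1 hx).2, hrle n])
  have hΦ1 : ∀ n θ, β - a ≤ θ → Φ n φ θ = 0 := by
    intro n θ hθ
    have hθ0 := h1 θ (by linarith)
    rw [← hθ0]
    refine (b n).normed_convolution_eq_right fun x hx ↦ ?_
    rw [hθ0]
    rw [Metric.mem_ball, Real.dist_eq] at hx
    exact h1 x (by linarith [(abs_lt.1 hx).1, hrle n])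
  have hsa : 0 < sin a := sin_pos_of_pos_of_lt_pi ha (by linarith [pi_pos])
  have hΦc : ∀ n, Continuous (Φ n φ) := fun n ↦ (hΦs n).continuous
  have lim1 : Filter.Tendsto (fun n ↦ ∫ θ in 0..β, Φ n φ θ ^ 2 / angularDist β θ ^ 2) Filter.atTop
      (nhds (∫ θ in 0..β, φ θ ^ 2 / angularDist β θ ^ 2)) := by
    refine intervalIntegral.tendsto_integral_filter_of_dominated_convergence
      (fun _ ↦ (3 * C) ^ 2 / sin a ^ 2) ?_ ?_ (by simp) ?_
    · exact Filter.Eventually.of_forall fun n ↦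
        (((hΦc n).measurable.pow_const 2).div
          ((measurable_angularDist β).pow_const 2)).aestronglyMeasurable
    · refine Filter.Eventually.of_forall fun n ↦ Filter.Eventually.of_forall fun θ _ ↦ ?_
      rw [Real.norm_eq_abs, abs_of_nonneg (by positivity)]
      by_cases h2 : θ ≤ a
      · rw [hΦ0 n θ h2]; simp; positivity
      by_cases h3 : β - a ≤ θ
      · rw [hΦ1 n θ h3]; simp; positivity
      have := sin_le_angularDist (β := β) (θ := θ) ha ha' (by linarith) (by linarith)
      have hsq : Φ n φ θ ^ 2 ≤ (3 * C) ^ 2 :=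
        sq_le_sq.2 ((hΦb n φ C hφc hC θ).trans (le_abs_self _))
      exact div_le_div₀ (by positivity) hsq (by positivity) (by gcongr)
    · exact Filter.Eventually.of_forall fun θ _ ↦ ((hΦt φ hφc θ).pow 2).div_const _
  have lim2 : Filter.Tendsto (fun n ↦ ∫ θ in 0..β, deriv (Φ n φ) θ ^ 2) Filter.atTop
      (nhds (∫ θ in 0..β, φ' θ ^ 2)) := by
    simp only [fun n ↦ funext fun x ↦ (hΦd n x).deriv]
    refine intervalIntegral.tendsto_integral_filter_of_dominated_convergence
      (fun _ ↦ (3 * C') ^ 2) ?_ ?_ (by simp) ?_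
    · refine Filter.Eventually.of_forall fun n ↦ Measurable.aestronglyMeasurable ?_
      rw [← funext fun x ↦ (hΦd n x).deriv]
      exact (measurable_deriv _).pow_const 2
    · refine Filter.Eventually.of_forall fun n ↦ Filter.Eventually.of_forall fun θ _ ↦ ?_
      rw [Real.norm_eq_abs, abs_of_nonneg (by positivity)]
      exact sq_le_sq.2 ((hΦb n φ' C' hφ' hC' θ).trans (le_abs_self _))
    · exact Filter.Eventually.of_forall fun θ _ ↦ (hΦt φ' hφ' θ).pow 2
  exact le_of_tendsto_of_tendsto' (lim1.const_mul c) lim2 fun n ↦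
    hsmooth _ (hΦs n) (hΦ0 n) (hΦ1 n)

lemma hasDerivAt_max_rpow {r : ℝ} (hr : 1 < r) (s : ℝ) :
    HasDerivAt (fun s : ℝ ↦ (max s 0) ^ r) (r * (max s 0) ^ (r - 1)) s := by
  rcases lt_trichotomy s 0 with h | rfl | h
  · rw [max_eq_right h.le, zero_rpow (by linarith), mul_zero]
    refine (hasDerivAt_const s (0:ℝ)).congr_of_eventuallyEq ?_
    filter_upwards [gt_mem_nhds h] with x hx
    rw [max_eq_right hx.le, zero_rpow (by linarith)]
  · have h2 : HasDerivAt (fun s : ℝ ↦ |s| ^ r) 0 0 := by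
      have := (hasDerivAt_abs_rpow (0:ℝ) hr)
      simpa using this
    rw [max_self, zero_rpow (by linarith), mul_zero]
    rw [hasDerivAt_iff_isLittleO] at h2 ⊢
    refine (Asymptotics.IsBigO.of_bound 1 (Filter.Eventually.of_forall fun x ↦ ?_)).trans_isLittleO h2
    have h3 : (max x 0) ^ r ≤ |x| ^ r :=
      rpow_le_rpow (le_max_right _ _) (max_le (le_abs_self _) (abs_nonneg _)) (by linarith)
    have h0 : (0:ℝ) ^ r = 0 := zero_rpow (by linarith)
    have h4 : 0 ≤ (max x 0) ^ r := rpow_nonneg (le_max_right _ _) _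
    simp [h0]
    rw [abs_of_nonneg h4, abs_of_nonneg (by positivity)]
    exact h3
  · rw [max_eq_left h.le]
    refine ((hasDerivAt_id s).rpow_const (p := r) (Or.inl h.ne')).congr_of_eventuallyEq ?_ |>.congr_deriv ?_
    · filter_upwards [lt_mem_nhds h] with x hx
      simp [max_eq_left hx.le]
    · simp

lemma energy_posPart_rpow {a b r : ℝ} (hab : a ≤ b) (hr : 1 < r) {ψ ψ' V : ℝ → ℝ}
    (d1 : ∀ x ∈ Set.Icc a b, HasDerivAt ψ (ψ' x) x)
    (d2 : ∀ x ∈ Set.Icc a b, HasDerivAt ψ' (-(V x * ψ x)) x) (hV : ContinuousOn V (Set.Icc a b)) :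
    ∫ x in a..b, (r * (max (ψ x) 0) ^ (r - 1) * ψ' x) ^ 2 = r ^ 2 / (2 * r - 1) *
      (ψ' b * (max (ψ b) 0) ^ (2 * r - 1) - ψ' a * (max (ψ a) 0) ^ (2 * r - 1) +
        ∫ x in a..b, V x * ((max (ψ x) 0) ^ r) ^ 2) := by
  have hψ : ContinuousOn ψ (Set.Icc a b) := fun x hx ↦ (d1 x hx).continuousAt.continuousWithinAt
  have hψ' : ContinuousOn ψ' (Set.Icc a b) := fun x hx ↦ (d2 x hx).continuousAt.continuousWithinAt
  have hm : ∀ s : ℝ, 0 ≤ s → ContinuousOn (fun x ↦ (max (ψ x) 0) ^ s) (Set.Icc a b) := fun s hs ↦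
    (hψ.sup continuousOn_const).rpow_const fun x _ ↦ Or.inr hs
  have e1 : ∀ x, ψ x * (max (ψ x) 0) ^ (2 * r - 1) = ((max (ψ x) 0) ^ r) ^ 2 := by
    intro x
    rcases le_or_gt (ψ x) 0 with h | h
    · rw [max_eq_right h, zero_rpow (by linarith), zero_rpow (by linarith)]; simp
    · rw [max_eq_left h.le, ← rpow_natCast, ← rpow_mul h.le, rpow_sub_one h.ne']
      field_simp
      ring_nf
  have e2 : ∀ x, (max (ψ x) 0) ^ (2 * r - 1 - 1) = ((max (ψ x) 0) ^ (r - 1)) ^ 2 := by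
    intro x
    rw [← rpow_natCast, ← rpow_mul (le_max_right _ _)]
    push_cast; ring_nf
  have hd : ∀ x ∈ Set.uIcc a b, HasDerivAt (fun x ↦ ψ' x * (max (ψ x) 0) ^ (2 * r - 1))
      (-(V x * ((max (ψ x) 0) ^ r) ^ 2) +
        (2 * r - 1) * (((max (ψ x) 0) ^ (r - 1)) ^ 2 * ψ' x ^ 2)) x := by
    intro x hx
    rw [Set.uIcc_of_le hab] at hx
    convert! (d2 x hx).mul ((hasDerivAt_max_rpow (r := 2 * r - 1) (by linarith) (ψ x)).comp x
      (d1 x hx)) using 1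
    simp only [Function.comp_apply]
    rw [← e1, e2]; ring
  have hc1 := hm (r - 1) (by linarith)
  have hc2 := hm r (by linarith)
  have i1 : IntervalIntegrable (fun x ↦ V x * ((max (ψ x) 0) ^ r) ^ 2) volume a b := by
    apply ContinuousOn.intervalIntegrable; rw [Set.uIcc_of_le hab]; fun_prop
  have i2 : IntervalIntegrable (fun x ↦ ((max (ψ x) 0) ^ (r - 1)) ^ 2 * ψ' x ^ 2) volume a b := by
    apply ContinuousOn.intervalIntegrable; rw [Set.uIcc_of_le hab]; fun_prop
  have i1' : IntervalIntegrable (fun x ↦ -(V x * ((max (ψ x) 0) ^ r) ^ 2)) volume a b := i1.neg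
  rw [← intervalIntegral.integral_eq_sub_of_hasDerivAt hd (i1'.add (i2.const_mul _)),
    intervalIntegral.integral_add i1' (i2.const_mul _), intervalIntegral.integral_neg,
    intervalIntegral.integral_const_mul]
  simp only [mul_pow, mul_assoc]
  rw [intervalIntegral.integral_const_mul]
  have h2r : 2 * r - 1 ≠ 0 := by linarith
  generalize (∫ x in a..b, (max (ψ x) 0 ^ (r - 1)) ^ 2 * ψ' x ^ 2) = I
  generalize (∫ x in a..b, V x * (max (ψ x) 0 ^ r) ^ 2) = J
  rw [div_mul_eq_mul_div, eq_div_iff h2r]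
  ring

lemma hasDerivAt_glue {a : ℝ} {f f' g g' : ℝ → ℝ} (hf : ∀ x ≤ a, HasDerivAt f (f' x) x)
    (hg : ∀ x, a ≤ x → HasDerivAt g (g' x) x) (h : f a = g a) (h' : f' a = g' a)
    (x : ℝ) : HasDerivAt (fun x ↦ if x ≤ a then f x else g x) (if x ≤ a then f' x else g' x) x := by
  rcases lt_trichotomy x a with hx | rfl | hx
  · rw [if_pos hx.le]
    refine (hf x hx.le).congr_of_eventuallyEq ?_
    filter_upwards [gt_mem_nhds hx] with y hy
    rw [if_pos hy.le]
  · rw [if_pos le_rfl]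
    have h1 : HasDerivWithinAt (fun y ↦ if y ≤ x then f y else g y) (f' x) (Set.Iic x) x :=
      (hf x le_rfl).hasDerivWithinAt.congr (fun y hy ↦ if_pos hy) (if_pos le_rfl)
    have h2 : HasDerivWithinAt (fun y ↦ if y ≤ x then f y else g y) (f' x) (Set.Ici x) x := by
      rw [h']
      refine (hg x le_rfl).hasDerivWithinAt.congr (fun y hy ↦ ?_) (by rw [if_pos le_rfl, h])
      rcases (show x ≤ y from hy).eq_or_lt with rfl | h3
      · rw [if_pos le_rfl, h]
      · rw [if_neg (not_le.2 h3)]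
    have := h1.union h2
    rwa [Set.Iic_union_Ici, hasDerivWithinAt_univ] at this
  · rw [if_neg (not_le.2 hx)]
    refine (hg x hx.le).congr_of_eventuallyEq ?_
    filter_upwards [lt_mem_nhds hx] with y hy
    rw [if_neg (not_le.2 hy)]

lemma continuous_glue {a : ℝ} {f g : ℝ → ℝ} (hf : ContinuousOn f (Set.Iic a))
    (hg : ContinuousOn g (Set.Ici a)) (h : f a = g a) :
    Continuous (fun x ↦ if x ≤ a then f x else g x) :=
  continuous_if_le continuous_id continuous_const hf hg fun x hx ↦ by
    rw [hx, h]

lemma exists_left_profile {α ρ r : ℝ} (h0 : 1 / 2 ≤ α) (h1 : α ≤ 1) (hρ : gammaSlope α < ρ)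
    (hr : 1 < r) : ∃ (ε : ℝ) (L L' : ℝ → ℝ), 0 < ε ∧ ε < π / 2 ∧
      (∀ θ ≤ π / 2, HasDerivAt L (L' θ) θ) ∧ ContinuousOn L' (Set.Iic (π / 2)) ∧
      (∀ θ ≤ ε, L θ = 0) ∧ L (π / 2) = 1 ∧ L' (π / 2) = r * ρ ∧
      ∫ θ in 0..π / 2, L' θ ^ 2 =
        r ^ 2 / (2 * r - 1) * (ρ + α * (1 - α) * ∫ θ in 0..π / 2, L θ ^ 2 / sin θ ^ 2) := by
  obtain ⟨ψ, ψ', d1, d2, hv, hv', -, hneg⟩ := exists_angular_solution h0 h1 ρ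
  obtain ⟨ε, hε, hε', hψ⟩ := hneg hρ
  have hpi := pi_pos
  have hmem : ∀ θ, ε ≤ θ → θ ≤ π / 2 → θ ∈ Set.Ioo 0 π := fun θ ha hb ↦
    ⟨by linarith, by linarith⟩
  set L : ℝ → ℝ := fun θ ↦ if θ ≤ ε / 2 then 0 else (max (ψ θ) 0) ^ r with hL
  set L' : ℝ → ℝ := fun θ ↦ if θ ≤ ε / 2 then 0 else r * (max (ψ θ) 0) ^ (r - 1) * ψ' θ with hL'
  have z : ∀ θ ≤ ε, L θ = 0 := by
    intro θ hθ
    simp only [hL]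
    split_ifs with h
    · rfl
    · rw [max_eq_right (hψ θ ⟨by linarith, hθ⟩).le, zero_rpow (by linarith)]
  have z' : ∀ θ ≤ ε, L' θ = 0 := by
    intro θ hθ
    simp only [hL']
    split_ifs with h
    · rfl
    · rw [max_eq_right (hψ θ ⟨by linarith, hθ⟩).le, zero_rpow (by linarith)]; simp
  have e : ∀ θ, ε ≤ θ → L θ = (max (ψ θ) 0) ^ r := fun θ hθ ↦ if_neg (by linarith)
  have e' : ∀ θ, ε ≤ θ → L' θ = r * (max (ψ θ) 0) ^ (r - 1) * ψ' θ :=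
    fun θ hθ ↦ if_neg (by linarith)
  have hc : ContinuousOn L' (Set.Iic (π / 2)) := by
    intro θ hθ
    apply ContinuousAt.continuousWithinAt
    rcases lt_or_ge θ ε with h | h
    · refine (continuousAt_const (y := (0:ℝ))).congr ?_
      filter_upwards [gt_mem_nhds h] with y hy
      exact (z' y hy.le).symm
    · have c1 := (d1 θ (hmem θ h hθ)).continuousAt
      have c2 := (d2 θ (hmem θ h hθ)).continuousAt
      refine ContinuousAt.congr (f := fun θ ↦ r * (max (ψ θ) 0) ^ (r - 1) * ψ' θ) ?_ ?_
      · refine (continuousAt_const.mul ((c1.max continuousAt_const).rpow_const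
          (Or.inr (by linarith)))).mul c2
      · filter_upwards [lt_mem_nhds (show ε / 2 < θ by linarith)] with y hy
        exact (if_neg (not_le.2 hy)).symm
  have hcL : ∀ a b, a ≤ b → b ≤ π / 2 → IntervalIntegrable (fun θ ↦ L' θ ^ 2) volume a b := by
    intro a b hab hb
    apply ContinuousOn.intervalIntegrable
    rw [Set.uIcc_of_le hab]
    exact (hc.mono fun x hx ↦ hx.2.trans hb).pow 2
  refine ⟨ε, L, L', hε, hε', ?_, hc, z, ?_, ?_, ?_⟩
  · intro θ hθ
    rcases lt_or_ge θ ε with h | h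
    · rw [z' θ h.le]
      refine (hasDerivAt_const θ (0:ℝ)).congr_of_eventuallyEq ?_
      filter_upwards [gt_mem_nhds h] with y hy
      exact z y hy.le
    · rw [e' θ h]
      refine ((hasDerivAt_max_rpow hr (ψ θ)).comp θ (d1 θ (hmem θ h hθ))).congr_of_eventuallyEq ?_
      filter_upwards [lt_mem_nhds (show ε / 2 < θ by linarith)] with y hy
      exact if_neg (not_le.2 hy)
  · rw [e _ hε'.le, hv]; simp
  · rw [e' _ hε'.le, hv, hv']; simp
  · rw [← intervalIntegral.integral_add_adjacent_intervals (hcL 0 ε hε.le hε'.le)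
      (hcL ε (π / 2) hε'.le le_rfl)]
    have hV : ContinuousOn (fun θ ↦ α * (1 - α) / sin θ ^ 2) (Set.Icc ε (π / 2)) := by
      refine continuousOn_const.div (by fun_prop) fun x hx ↦ ?_
      exact pow_ne_zero 2 (sin_pos_of_pos_of_lt_pi (by linarith [hx.1]) (by linarith [hx.2])).ne'
    have key := energy_posPart_rpow hε'.le hr (fun x hx ↦ d1 x (hmem x hx.1 hx.2))
      (fun x hx ↦ d2 x (hmem x hx.1 hx.2)) hV
    rw [max_eq_right (hψ ε ⟨hε, le_rfl⟩).le, zero_rpow (by linarith), hv, hv'] at key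
    have k1 : ∫ θ in 0..ε, L' θ ^ 2 = 0 := by
      rw [intervalIntegral.integral_congr (g := fun _ ↦ (0:ℝ))]
      · simp
      · intro θ hθ
        rw [Set.uIcc_of_le hε.le] at hθ
        simp [z' θ hθ.2]
    have k2 : ∫ θ in ε..π / 2, L' θ ^ 2 =
        ∫ x in ε..π / 2, (r * (max (ψ x) 0) ^ (r - 1) * ψ' x) ^ 2 := by
      refine intervalIntegral.integral_congr fun θ hθ ↦ ?_
      rw [Set.uIcc_of_le hε'.le] at hθ
      simp only [e' θ hθ.1]
    have k4 : ∫ θ in ε..π / 2, L θ ^ 2 / sin θ ^ 2 =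
        ∫ x in ε..π / 2, ((max (ψ x) 0) ^ r) ^ 2 / sin x ^ 2 := by
      refine intervalIntegral.integral_congr fun θ hθ ↦ ?_
      rw [Set.uIcc_of_le hε'.le] at hθ
      simp only [e θ hθ.1]
    have z0 : ∫ θ in 0..ε, L θ ^ 2 / sin θ ^ 2 = 0 := by
      rw [intervalIntegral.integral_congr (g := fun _ ↦ (0:ℝ))]
      · simp
      · intro θ hθ
        rw [Set.uIcc_of_le hε.le] at hθ
        simp [z θ hθ.2]
    have hLc : ContinuousOn (fun x ↦ ((max (ψ x) 0) ^ r) ^ 2 / sin x ^ 2) (Set.Icc ε (π / 2)) := by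
      have hψc : ContinuousOn ψ (Set.Icc ε (π / 2)) := fun x hx ↦
        (d1 x (hmem x hx.1 hx.2)).continuousAt.continuousWithinAt
      refine (((hψc.sup continuousOn_const).rpow_const fun x _ ↦ Or.inr (by linarith)).pow 2).div
        (by fun_prop) fun x hx ↦ ?_
      exact pow_ne_zero 2 (sin_pos_of_pos_of_lt_pi (by linarith [hx.1]) (by linarith [hx.2])).ne'
    have k3 : ∫ θ in 0..π / 2, L θ ^ 2 / sin θ ^ 2 = ∫ θ in ε..π / 2, L θ ^ 2 / sin θ ^ 2 := by
      rw [← intervalIntegral.integral_add_adjacent_intervals (b := ε), z0, zero_add]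
      · refine (intervalIntegrable_const (c := (0:ℝ))).congr fun θ hθ ↦ ?_
        rw [Set.uIoc_of_le hε.le] at hθ
        simp [z θ hθ.2]
      · refine (ContinuousOn.intervalIntegrable (by rwa [Set.uIcc_of_le hε'.le])).congr
          (f := fun x ↦ ((max (ψ x) 0) ^ r) ^ 2 / sin x ^ 2) fun θ hθ ↦ ?_
        rw [Set.uIoc_of_le hε'.le] at hθ
        simp only [e θ hθ.1.le]
    rw [k1, k2, key, zero_add, k3, k4, ← intervalIntegral.integral_const_mul]
    simp only [max_eq_left zero_le_one, one_rpow, mul_one, mul_zero, sub_zero]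
    congr 2
    refine intervalIntegral.integral_congr fun θ _ ↦ ?_
    ring

lemma exists_middle_profile {β κ r : ℝ} (hβ : β ∈ Set.Icc π (2 * π)) (hκ0 : 0 ≤ κ) (hκ1 : κ < 1)
    (hr : 1 < r) : ∃ M M' : ℝ → ℝ, (∀ θ, HasDerivAt M (M' θ) θ) ∧ Continuous M' ∧
      M (π / 2) = 1 ∧ M (β - π / 2) = 1 ∧ M' (π / 2) = r * (κ * tan (κ * (β - π) / 2)) ∧
      M' (β - π / 2) = -(r * (κ * tan (κ * (β - π) / 2))) ∧
      ∫ θ in (π / 2)..(β - π / 2), M' θ ^ 2 = r ^ 2 / (2 * r - 1) *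
        (-2 * (κ * tan (κ * (β - π) / 2)) + κ ^ 2 * ∫ θ in (π / 2)..(β - π / 2), M θ ^ 2) := by
  have hpi := pi_pos
  have hx0 : 0 ≤ κ * (β - π) / 2 := by
    have := mul_nonneg hκ0 (sub_nonneg.2 hβ.1)
    linarith
  have hx1 : κ * (β - π) / 2 < π / 2 := by
    have : κ * (β - π) ≤ κ * π := by
      apply mul_le_mul_of_nonneg_left _ hκ0; linarith [hβ.2]
    have : κ * π < 1 * π := by gcongr
    linarith
  set x := κ * (β - π) / 2 with hx
  have hcos : 0 < cos x := cos_pos_of_mem_Ioo ⟨by linarith, hx1⟩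
  let N : ℝ → ℝ := fun θ ↦ cos (κ * (θ - β / 2)) / cos x
  let N' : ℝ → ℝ := fun θ ↦ -κ * sin (κ * (θ - β / 2)) / cos x
  have dlin : ∀ θ, HasDerivAt (fun θ ↦ κ * (θ - β / 2)) κ θ := fun θ ↦ by
    simpa using ((hasDerivAt_id θ).sub_const (β / 2)).const_mul κ
  have d1 : ∀ θ, HasDerivAt N (N' θ) θ := fun θ ↦ by
    refine ((dlin θ).cos.div_const (cos x)).congr_deriv ?_
    simp only [N']; ring
  have d2 : ∀ θ, HasDerivAt N' (-(κ ^ 2 * N θ)) θ := fun θ ↦ by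
    refine (((dlin θ).sin.const_mul (-κ)).div_const (cos x)).congr_deriv ?_
    simp only [N]; ring
  have a1 : κ * (π / 2 - β / 2) = -x := by rw [hx]; ring
  have a2 : κ * (β - π / 2 - β / 2) = x := by rw [hx]; ring
  have n1 : N (π / 2) = 1 := by simp only [N, a1, cos_neg]; exact div_self hcos.ne'
  have n2 : N (β - π / 2) = 1 := by simp only [N, a2]; exact div_self hcos.ne'
  have n3 : N' (π / 2) = κ * tan x := by
    simp only [N', a1, sin_neg, tan_eq_sin_div_cos]; ring
  have n4 : N' (β - π / 2) = -(κ * tan x) := by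
    simp only [N', a2, tan_eq_sin_div_cos]; ring
  have hN : Continuous N := continuous_iff_continuousAt.2 fun x ↦ (d1 x).continuousAt
  have hN' : Continuous N' := continuous_iff_continuousAt.2 fun x ↦ (d2 x).continuousAt
  refine ⟨fun θ ↦ (max (N θ) 0) ^ r, fun θ ↦ r * (max (N θ) 0) ^ (r - 1) * N' θ,
    fun θ ↦ (hasDerivAt_max_rpow hr (N θ)).comp θ (d1 θ), ?_, ?_, ?_, ?_, ?_, ?_⟩
  · exact (continuous_const.mul ((hN.max continuous_const).rpow_const
      fun _ ↦ Or.inr (by linarith))).mul hN'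
  · simp [n1]
  · simp [n2]
  · simp [n1, n3]
  · simp [n2, n4]
  · have key := energy_posPart_rpow (a := π / 2) (b := β - π / 2) (by linarith [hβ.1]) hr
      (fun x _ ↦ d1 x) (V := fun _ ↦ κ ^ 2) (fun x _ ↦ d2 x) continuousOn_const
    rw [key, n1, n2, n3, n4, intervalIntegral.integral_const_mul]
    simp only [max_eq_left zero_le_one, one_rpow, mul_one]
    ring

lemma exists_angular_test_function {α β κ c : ℝ} (h0 : 1 / 2 ≤ α) (h1 : α ≤ 1)
    (hβ : β ∈ Set.Icc π (2 * π)) (hκ0 : 0 ≤ κ) (hκ1 : κ < 1) (hκ : κ ^ 2 = α * (1 - α))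
    (hR : κ * tan (κ * (β - π) / 2) = gammaSlope α) (hc : κ ^ 2 < c) :
    ∃ (a : ℝ) (φ φ' : ℝ → ℝ), 0 < a ∧ a ≤ π / 2 ∧ (∀ θ, HasDerivAt φ (φ' θ) θ) ∧ Continuous φ' ∧
      (∀ θ, θ ≤ 2 * a → φ θ = 0) ∧ (∀ θ, β - 2 * a ≤ θ → φ θ = 0) ∧
      ∫ θ in 0..β, φ' θ ^ 2 < c * ∫ θ in 0..β, φ θ ^ 2 / angularDist β θ ^ 2 := by
  have hpi := pi_pos
  have hRpos := gammaSlope_pos (show 0 < α by linarith)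
  have hκpos : 0 < κ := hκ0.lt_of_ne fun h ↦ by rw [← h, zero_mul] at hR; linarith
  have hβpos : π < β := hβ.1.lt_of_ne fun h ↦ by rw [← h] at hR; simp at hR; linarith
  obtain ⟨k, ⟨hk, hk1⟩, hkc⟩ : ∃ k, (κ < k ∧ k < 1) ∧ k ^ 2 < c := by
    have e1 : ∀ᶠ k in nhdsWithin κ (Set.Ioi κ), κ < k ∧ k < 1 := Ioo_mem_nhdsGT hκ1
    have e2 : ∀ᶠ k in nhdsWithin κ (Set.Ioi κ), k ^ 2 < c :=
      nhdsWithin_le_nhds ((continuous_pow 2).continuousAt.eventually (gt_mem_nhds hc))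
    exact (e1.and e2).exists
  obtain ⟨r, hr, hrc⟩ : ∃ r : ℝ, 1 < r ∧ r ^ 2 / (2 * r - 1) * k ^ 2 < c := by
    have e2 : ∀ᶠ r : ℝ in nhdsWithin 1 (Set.Ioi 1), r ^ 2 / (2 * r - 1) * k ^ 2 < c := by
      have hcont : ContinuousAt (fun r : ℝ ↦ r ^ 2 / (2 * r - 1) * k ^ 2) 1 := by
        refine ContinuousAt.mul (ContinuousAt.div ?_ ?_ ?_) continuousAt_const
        · fun_prop
        · fun_prop
        · norm_num
      refine nhdsWithin_le_nhds (hcont.eventually (gt_mem_nhds ?_))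
      norm_num; exact hkc
    exact ((eventually_nhdsWithin_of_forall fun r hr ↦ hr).and e2).exists
  have hρ : gammaSlope α < k * tan (k * (β - π) / 2) := by
    rw [← hR]
    have hlt : κ * (β - π) / 2 < k * (β - π) / 2 := by
      have := mul_lt_mul_of_pos_right hk (sub_pos.2 hβpos)
      linarith
    have hx0 : 0 ≤ κ * (β - π) / 2 := by
      have := mul_nonneg hκ0 (sub_nonneg.2 hβ.1)
      linarith
    have hx1 : k * (β - π) / 2 < π / 2 := by
      have : k * (β - π) ≤ k * π := by
        apply mul_le_mul_of_nonneg_left _ (by linarith); linarith [hβ.2]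
      have : k * π < 1 * π := by gcongr
      linarith
    have ht := tan_lt_tan_of_nonneg_of_lt_pi_div_two hx0 hx1 hlt
    have ht0 : 0 ≤ tan (κ * (β - π) / 2) := tan_nonneg_of_nonneg_of_le_pi_div_two hx0 (by linarith)
    nlinarith
  obtain ⟨ε, L, L', hε, hε', hL, hLc, hL0, hL1, hL1', hLE⟩ := exists_left_profile h0 h1 hρ hr
  obtain ⟨M, M', hM, hMc, hM1, hM2, hM1', hM2', hME⟩ :=
    exists_middle_profile hβ (hκ0.trans hk.le) hk1 hr
  set ρ := k * tan (k * (β - π) / 2) with hρdef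
  let G : ℝ → ℝ := fun θ ↦ if θ ≤ β - π / 2 then M θ else L (β - θ)
  let G' : ℝ → ℝ := fun θ ↦ if θ ≤ β - π / 2 then M' θ else -L' (β - θ)
  have hG : ∀ θ, HasDerivAt G (G' θ) θ := by
    refine hasDerivAt_glue (fun x _ ↦ hM x) (fun x hx ↦ ?_) ?_ ?_
    · exact (hL (β - x) (by linarith)).comp_const_sub β x
    · simp [hM2, hL1]
    · simp [hM2', hL1']
  have hGc : Continuous G' := by
    refine continuous_glue hMc.continuousOn ?_ ?_
    · exact (hLc.comp (f := fun x ↦ β - x) (by fun_prop) fun x (hx : β - π / 2 ≤ x) ↦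
        show β - x ≤ π / 2 by linarith).neg
    · simp [hM2', hL1']
  have gM : ∀ θ ≤ β - π / 2, G θ = M θ := fun θ h ↦ if_pos h
  have gM' : ∀ θ ≤ β - π / 2, G' θ = M' θ := fun θ h ↦ if_pos h
  let φ : ℝ → ℝ := fun θ ↦ if θ ≤ π / 2 then L θ else G θ
  let φ' : ℝ → ℝ := fun θ ↦ if θ ≤ π / 2 then L' θ else G' θ
  have hφ : ∀ θ, HasDerivAt φ (φ' θ) θ := by
    refine hasDerivAt_glue hL (fun x _ ↦ hG x) ?_ ?_
    · rw [gM _ (by linarith), hL1, hM1]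
    · rw [gM' _ (by linarith), hL1', hM1']
  have hφc : Continuous φ' := by
    refine continuous_glue hLc hGc.continuousOn ?_
    rw [gM' _ (by linarith), hL1', hM1']
  have pL : ∀ θ ≤ π / 2, φ θ = L θ := fun θ h ↦ if_pos h
  have pL' : ∀ θ ≤ π / 2, φ' θ = L' θ := fun θ h ↦ if_pos h
  have pM : ∀ θ, π / 2 ≤ θ → θ ≤ β - π / 2 → φ θ = M θ := by
    intro θ h h'
    rcases h.eq_or_lt with rfl | h2
    · rw [pL _ le_rfl, hL1, hM1]
    · rw [← gM θ h']; exact if_neg (not_le.2 h2)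
  have pM' : ∀ θ, π / 2 ≤ θ → θ ≤ β - π / 2 → φ' θ = M' θ := by
    intro θ h h'
    rcases h.eq_or_lt with rfl | h2
    · rw [pL' _ le_rfl, hL1', hM1']
    · rw [← gM' θ h']; exact if_neg (not_le.2 h2)
  have pR : ∀ θ ≤ π / 2, φ (β - θ) = L θ := by
    intro θ h
    rcases h.eq_or_lt with rfl | h2
    · rw [pM _ (by linarith) le_rfl, hM2, hL1]
    · have : φ (β - θ) = G (β - θ) := if_neg (by linarith)
      rw [this]
      have : G (β - θ) = L (β - (β - θ)) := if_neg (by linarith)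
      rw [this]; congr 1; ring
  have pR' : ∀ θ ≤ π / 2, φ' (β - θ) = -L' θ := by
    intro θ h
    rcases h.eq_or_lt with rfl | h2
    · rw [pM' _ (by linarith) le_rfl, hM2', hL1']
    · have : φ' (β - θ) = G' (β - θ) := if_neg (by linarith)
      rw [this]
      have : G' (β - θ) = -L' (β - (β - θ)) := if_neg (by linarith)
      rw [this]; congr 2; ring
  have z0 : ∀ θ, θ ≤ 2 * (ε / 2) → φ θ = 0 := fun θ h ↦ by
    rw [pL _ (by linarith), hL0 _ (by linarith)]
  have z1 : ∀ θ, β - 2 * (ε / 2) ≤ θ → φ θ = 0 := fun θ h ↦ by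
    have := pR (β - θ) (by linarith)
    rw [sub_sub_cancel] at this
    rw [this, hL0 _ (by linarith)]
  refine ⟨ε / 2, φ, φ', by positivity, by linarith, hφ, hφc, z0, z1, ?_⟩
  have hcont : Continuous φ := continuous_iff_continuousAt.2 fun x ↦ (hφ x).continuousAt
  rw [integral_div_angularDist (a := ε) hβ.1 hε hε'.le hcont (fun θ h ↦ z0 θ (by linarith [h.2]))
    (fun θ h ↦ z1 θ (by linarith [h.1]))]
  have hi : ∀ a b, IntervalIntegrable (fun θ ↦ φ' θ ^ 2) volume a b := fun a b ↦
    (hφc.pow 2).intervalIntegrable a b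
  rw [← intervalIntegral.integral_add_adjacent_intervals (hi 0 (β - π / 2)) (hi _ β),
    ← intervalIntegral.integral_add_adjacent_intervals (hi 0 (π / 2)) (hi _ (β - π / 2))]
  have i3 : ∫ θ in (β - π / 2)..β, φ' θ ^ 2 = ∫ θ in 0..π / 2, L' θ ^ 2 := by
    have := intervalIntegral.integral_comp_sub_left (fun θ ↦ φ' θ ^ 2) (a := 0) (b := π / 2) β
    rw [sub_zero] at this
    rw [← this]
    refine intervalIntegral.integral_congr fun θ hθ ↦ ?_
    rw [Set.uIcc_of_le (by linarith)] at hθ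
    simp [pR' θ hθ.2]
  have i1 : ∫ θ in 0..π / 2, φ' θ ^ 2 = ∫ θ in 0..π / 2, L' θ ^ 2 := by
    refine intervalIntegral.integral_congr fun θ hθ ↦ ?_
    rw [Set.uIcc_of_le (by linarith)] at hθ
    simp [pL' θ hθ.2]
  have i2 : ∫ θ in (π / 2)..(β - π / 2), φ' θ ^ 2 = ∫ θ in (π / 2)..(β - π / 2), M' θ ^ 2 := by
    refine intervalIntegral.integral_congr fun θ hθ ↦ ?_
    rw [Set.uIcc_of_le (by linarith)] at hθ
    simp [pM' θ hθ.1 hθ.2]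
  have j1 : ∫ θ in 0..π / 2, φ θ ^ 2 / sin θ ^ 2 = ∫ θ in 0..π / 2, L θ ^ 2 / sin θ ^ 2 := by
    refine intervalIntegral.integral_congr fun θ hθ ↦ ?_
    rw [Set.uIcc_of_le (by linarith)] at hθ
    simp [pL θ hθ.2]
  have j2 : ∫ θ in (π / 2)..(β - π / 2), φ θ ^ 2 = ∫ θ in (π / 2)..(β - π / 2), M θ ^ 2 := by
    refine intervalIntegral.integral_congr fun θ hθ ↦ ?_
    rw [Set.uIcc_of_le (by linarith)] at hθ
    simp [pM θ hθ.1 hθ.2]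
  have j3 : ∫ θ in 0..π / 2, φ (β - θ) ^ 2 / sin θ ^ 2 = ∫ θ in 0..π / 2, L θ ^ 2 / sin θ ^ 2 := by
    refine intervalIntegral.integral_congr fun θ hθ ↦ ?_
    rw [Set.uIcc_of_le (by linarith)] at hθ
    simp [pR θ hθ.2]
  rw [i1, i2, i3, j1, j2, j3]
  have hq : 0 < r ^ 2 / (2 * r - 1) := div_pos (by positivity) (by linarith)
  set q := r ^ 2 / (2 * r - 1) with hqdef
  have hJ : 0 ≤ ∫ θ in 0..π / 2, L θ ^ 2 / sin θ ^ 2 :=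
    intervalIntegral.integral_nonneg (by linarith) fun θ _ ↦ by positivity
  have hM0 : 0 ≤ ∫ θ in (π / 2)..(β - π / 2), M' θ ^ 2 :=
    intervalIntegral.integral_nonneg (by linarith) fun θ _ ↦ by positivity
  rw [hME] at hM0 ⊢
  rw [hLE, ← hκ]
  generalize (∫ θ in 0..π / 2, L θ ^ 2 / sin θ ^ 2) = J at *
  generalize (∫ θ in (π / 2)..(β - π / 2), M θ ^ 2) = I at *
  have hI : 0 < I := by
    have h3 := nonneg_of_mul_nonneg_right hM0 hq
    have h4 : 0 < k ^ 2 * I := by linarith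
    exact pos_of_mul_pos_right h4 (by positivity)
  have hk2 : κ ^ 2 ≤ k ^ 2 := by gcongr
  calc _ = q * (κ ^ 2 * (2 * J) + k ^ 2 * I) := by ring
    _ ≤ q * (k ^ 2 * (2 * J) + k ^ 2 * I) := by gcongr
    _ = (q * k ^ 2) * (2 * J + I) := by ring
    _ < c * (2 * J + I) := by gcongr
    _ = _ := by ring

/-- Logarithmic polar coordinates in the plane. -/
noncomputable def logPolar (t θ : ℝ) : EuclideanSpace ℝ (Fin 2) := !₂[exp t * cos θ, exp t * sin θ]

lemma logPolar_mem_sector {β t θ : ℝ} (h0 : 0 < θ) (h1 : θ < β) : logPolar t θ ∈ sector β :=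
  ⟨exp t, θ, exp_pos t, h0, h1, by simp [logPolar], by simp [logPolar]⟩

lemma exists_logPolar_of_mem_sector {β : ℝ} {x : EuclideanSpace ℝ (Fin 2)} (hx : x ∈ sector β) :
    ∃ t θ, 0 < θ ∧ θ < β ∧ x = logPolar t θ := by
  obtain ⟨r, θ, hr, h0, h1, hx0, hx1⟩ := hx
  refine ⟨log r, θ, h0, h1, ?_⟩
  ext i
  fin_cases i
  · simp [logPolar, exp_log hr, hx0]
  · simp [logPolar, exp_log hr, hx1]

lemma injOn_logPolar {β : ℝ} (hβ : β ≤ 2 * π) :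
    Set.InjOn (fun p : ℝ × ℝ ↦ (exp p.1 * cos p.2, exp p.1 * sin p.2))
      (Set.univ ×ˢ Set.Ioo 0 β) := by
  rintro ⟨t, θ⟩ ⟨-, h⟩ ⟨s, ω⟩ ⟨-, h'⟩ heq
  simp only [Prod.mk.injEq] at heq h h'
  obtain ⟨e1, e2⟩ := heq
  have hr : exp t = exp s := by
    have : exp t ^ 2 = exp s ^ 2 := by
      calc exp t ^ 2 = (exp t * cos θ) ^ 2 + (exp t * sin θ) ^ 2 := by
            linear_combination -(exp t ^ 2) * sin_sq_add_cos_sq θ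
        _ = (exp s * cos ω) ^ 2 + (exp s * sin ω) ^ 2 := by rw [e1, e2]
        _ = exp s ^ 2 := by linear_combination (exp s ^ 2) * sin_sq_add_cos_sq ω
    exact (pow_left_inj₀ (exp_pos t).le (exp_pos s).le two_ne_zero).1 this
  rw [hr] at e1 e2
  have c := mul_left_cancel₀ (exp_pos s).ne' e1
  have d := mul_left_cancel₀ (exp_pos s).ne' e2
  have : cos (θ - ω) = 1 := by
    rw [cos_sub, c, d]; linear_combination sin_sq_add_cos_sq ω
  have := (cos_eq_one_iff_of_lt_of_lt (by linarith [h.1, h'.2]) (by linarith [h.2, h'.1])).1 this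
  ext
  · exact exp_injective hr
  · simp; linarith

/-- The derivative of the logarithmic polar coordinates. -/
noncomputable def fderivLogPolar (p : ℝ × ℝ) : ℝ × ℝ →L[ℝ] ℝ × ℝ :=
  (Matrix.toLin (.finTwoProd ℝ) (.finTwoProd ℝ)
    !![exp p.1 * cos p.2, -exp p.1 * sin p.2;
      exp p.1 * sin p.2, exp p.1 * cos p.2]).toContinuousLinearMap

lemma hasFDerivAt_logPolar (p : ℝ × ℝ) :
    HasFDerivAt (fun p : ℝ × ℝ ↦ (exp p.1 * cos p.2, exp p.1 * sin p.2)) (fderivLogPolar p) p := by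
  unfold fderivLogPolar
  rw [Matrix.toLin_finTwoProd_toContinuousLinearMap]
  have he : HasFDerivAt (fun p : ℝ × ℝ ↦ exp p.1) (exp p.1 • ContinuousLinearMap.fst ℝ ℝ ℝ) p :=
    (hasDerivAt_exp p.1).comp_hasFDerivAt p hasFDerivAt_fst
  convert! HasFDerivAt.prodMk (𝕜 := ℝ)
      (he.mul ((hasDerivAt_cos p.2).comp_hasFDerivAt p hasFDerivAt_snd))
      (he.mul ((hasDerivAt_sin p.2).comp_hasFDerivAt p hasFDerivAt_snd)) using 2 <;>
  · ext <;> simp [mul_comm]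

lemma det_fderivLogPolar (p : ℝ × ℝ) : (fderivLogPolar p).det = exp p.1 ^ 2 := by
  unfold fderivLogPolar
  simp only [LinearMap.det_toContinuousLinearMap, LinearMap.det_toLin, Matrix.det_fin_two_of]
  linear_combination (exp p.1 ^ 2) * sin_sq_add_cos_sq p.2

lemma measurePreserving_vecTwo : MeasurePreserving
    (fun p : ℝ × ℝ ↦ (!₂[p.1, p.2] : EuclideanSpace ℝ (Fin 2))) := by
  have h1 := (volume_preserving_finTwoArrow ℝ).symm
  have h2 := EuclideanSpace.volume_preserving_symm_measurableEquiv_toLp (Fin 2)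
  exact h2.symm.comp h1

lemma measurableEmbedding_vecTwo : MeasurableEmbedding
    (fun p : ℝ × ℝ ↦ (!₂[p.1, p.2] : EuclideanSpace ℝ (Fin 2))) :=
  (MeasurableEquiv.finTwoArrow.symm.trans (MeasurableEquiv.toLp 2 (Fin 2 → ℝ))).measurableEmbedding

lemma vecTwo_preimage_sector (β : ℝ) :
    (fun p : ℝ × ℝ ↦ (!₂[p.1, p.2] : EuclideanSpace ℝ (Fin 2))) ⁻¹' sector β =
    (fun p : ℝ × ℝ ↦ (exp p.1 * cos p.2, exp p.1 * sin p.2)) '' (Set.univ ×ˢ Set.Ioo 0 β) := by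
  ext ⟨x, y⟩
  constructor
  · intro h
    obtain ⟨t, θ, h0, h1, h2⟩ := exists_logPolar_of_mem_sector (Set.mem_preimage.1 h)
    refine ⟨(t, θ), ⟨trivial, h0, h1⟩, ?_⟩
    have e0 := congrArg (fun v : EuclideanSpace ℝ (Fin 2) ↦ v 0) h2
    have e1 := congrArg (fun v : EuclideanSpace ℝ (Fin 2) ↦ v 1) h2
    simp [logPolar] at e0 e1
    simp [e0, e1]
  · rintro ⟨⟨t, θ⟩, ⟨-, h0, h1⟩, h⟩
    simp only [Prod.mk.injEq] at h
    rw [Set.mem_preimage, ← h.1, ← h.2]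
    exact logPolar_mem_sector h0 h1

lemma setIntegral_sector {β : ℝ} (hβ : β ≤ 2 * π) (F : EuclideanSpace ℝ (Fin 2) → ℝ) :
    ∫ x in sector β, F x =
      ∫ p in Set.univ ×ˢ Set.Ioo 0 β, exp p.1 ^ 2 * F (logPolar p.1 p.2) := by
  rw [← measurePreserving_vecTwo.setIntegral_preimage_emb measurableEmbedding_vecTwo,
    vecTwo_preimage_sector, integral_image_eq_integral_abs_det_fderiv_smul volume
      (MeasurableSet.univ.prod measurableSet_Ioo)
      (fun p _ ↦ (hasFDerivAt_logPolar p).hasFDerivWithinAt) (injOn_logPolar hβ)]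
  simp only [det_fderivLogPolar, abs_sq, smul_eq_mul]
  rfl

lemma integrableOn_sector {β : ℝ} (hβ : β ≤ 2 * π) {F : EuclideanSpace ℝ (Fin 2) → ℝ}
    (hF : Integrable F) : IntegrableOn (fun p : ℝ × ℝ ↦ exp p.1 ^ 2 * F (logPolar p.1 p.2))
      (Set.univ ×ˢ Set.Ioo 0 β) := by
  have h := (measurePreserving_vecTwo.integrableOn_comp_preimage measurableEmbedding_vecTwo).2
    (hF.integrableOn (s := sector β))
  rw [vecTwo_preimage_sector, integrableOn_image_iff_integrableOn_abs_det_fderiv_smul volume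
      (MeasurableSet.univ.prod measurableSet_Ioo)
      (fun p _ ↦ (hasFDerivAt_logPolar p).hasFDerivWithinAt) (injOn_logPolar hβ)] at h
  simp only [det_fderivLogPolar, abs_sq, smul_eq_mul] at h
  exact h

lemma hasDerivAt_vecTwo {f g : ℝ → ℝ} {f' g' x : ℝ} (hf : HasDerivAt f f' x)
    (hg : HasDerivAt g g' x) :
    HasDerivAt (fun x ↦ (!₂[f x, g x] : EuclideanSpace ℝ (Fin 2))) !₂[f', g'] x := by
  have h : HasDerivAt (fun x ↦ (![f x, g x] : Fin 2 → ℝ)) ![f', g'] x := by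
    refine hasDerivAt_pi.2 fun i ↦ ?_
    fin_cases i
    · simpa using hf
    · simpa using hg
  exact (PiLp.continuousLinearEquiv 2 ℝ (fun _ : Fin 2 ↦ ℝ)).symm.hasFDerivAt.comp_hasDerivAt x h

lemma hasDerivAt_logPolar_radial (t θ : ℝ) :
    HasDerivAt (fun t ↦ logPolar t θ) !₂[exp t * cos θ, exp t * sin θ] t :=
  hasDerivAt_vecTwo ((hasDerivAt_exp t).mul_const _) ((hasDerivAt_exp t).mul_const _)

lemma hasDerivAt_logPolar_angular (t θ : ℝ) :
    HasDerivAt (fun θ ↦ logPolar t θ) !₂[exp t * -sin θ, exp t * cos θ] θ :=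
  hasDerivAt_vecTwo ((hasDerivAt_cos θ).const_mul _) ((hasDerivAt_sin θ).const_mul _)

lemma exp_sq_mul_norm_gradient_sq {u : EuclideanSpace ℝ (Fin 2) → ℝ} {t θ wt wθ : ℝ}
    (hu : DifferentiableAt ℝ u (logPolar t θ)) (ht : HasDerivAt (fun t ↦ u (logPolar t θ)) wt t)
    (hθ : HasDerivAt (fun θ ↦ u (logPolar t θ)) wθ θ) :
    exp t ^ 2 * ‖gradient u (logPolar t θ)‖ ^ 2 = wt ^ 2 + wθ ^ 2 := by
  have h := hu.hasGradientAt.hasFDerivAt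
  have e1 := ht.unique (h.comp_hasDerivAt t (hasDerivAt_logPolar_radial t θ))
  have e2 := hθ.unique (h.comp_hasDerivAt θ (hasDerivAt_logPolar_angular t θ))
  simp only [InnerProductSpace.toDual_apply_apply, PiLp.inner_apply, Fin.sum_univ_two] at e1 e2
  simp at e1 e2
  rw [e1, e2, EuclideanSpace.norm_sq_eq, Fin.sum_univ_two]
  simp only [norm_eq_abs, sq_abs]
  generalize gradient u (logPolar t θ) 0 = a
  generalize gradient u (logPolar t θ) 1 = b
  linear_combination -(exp t ^ 2 * (a ^ 2 + b ^ 2)) * sin_sq_add_cos_sq θ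

lemma notMem_sector {β s ω : ℝ} (hβ : β ≤ 2 * π) (hs : 0 ≤ s) (hω : ω ∈ Set.Icc β (2 * π)) :
    (!₂[s * cos ω, s * sin ω] : EuclideanSpace ℝ (Fin 2)) ∉ sector β := by
  rintro ⟨r, θ, hr, h0, h1, e1, e2⟩
  simp at e1 e2
  have hrs : s = r := by
    have : s ^ 2 = r ^ 2 := by
      calc s ^ 2 = (s * cos ω) ^ 2 + (s * sin ω) ^ 2 := by
            linear_combination -(s ^ 2) * sin_sq_add_cos_sq ω
        _ = (r * cos θ) ^ 2 + (r * sin θ) ^ 2 := by rw [e1, e2]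
        _ = r ^ 2 := by linear_combination (r ^ 2) * sin_sq_add_cos_sq θ
    exact (pow_left_inj₀ hs hr.le two_ne_zero).1 this
  rw [hrs] at e1 e2
  have c := mul_left_cancel₀ hr.ne' e1
  have d := mul_left_cancel₀ hr.ne' e2
  have h : cos (θ - ω) = 1 := by
    rw [cos_sub, c, d]; linear_combination sin_sq_add_cos_sq θ
  have := (cos_eq_one_iff_of_lt_of_lt (by linarith [hω.2]) (by linarith [hω.1])).1 h
  linarith [hω.1]

lemma exists_polar_of_notMem_sector {β : ℝ} (hβ : β ≤ 2 * π) {y : EuclideanSpace ℝ (Fin 2)}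
    (hy : y ∉ sector β) :
    ∃ s ω, 0 ≤ s ∧ ω ∈ Set.Icc β (2 * π) ∧ y = !₂[s * cos ω, s * sin ω] := by
  set z : ℂ := ⟨y 0, y 1⟩ with hz
  have e0 : y 0 = ‖z‖ * cos z.arg := (Complex.norm_mul_cos_arg z).symm
  have e1 : y 1 = ‖z‖ * sin z.arg := (Complex.norm_mul_sin_arg z).symm
  have key : ∀ ω, 0 < ω → ω ≤ 2 * π → y 0 = ‖z‖ * cos ω → y 1 = ‖z‖ * sin ω →
      ∃ s ω, 0 ≤ s ∧ ω ∈ Set.Icc β (2 * π) ∧ y = !₂[s * cos ω, s * sin ω] := by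
    intro ω h0 h1 h2 h3
    have hyeq : y = !₂[‖z‖ * cos ω, ‖z‖ * sin ω] := by
      ext i; fin_cases i
      · simpa using h2
      · simpa using h3
    rcases (norm_nonneg z).eq_or_lt with h4 | h4
    · refine ⟨0, β, le_rfl, ⟨le_rfl, hβ⟩, ?_⟩
      rw [hyeq, ← h4]; simp
    · refine ⟨‖z‖, ω, h4.le, ⟨?_, h1⟩, hyeq⟩
      by_contra h5
      exact hy ⟨‖z‖, ω, h4, h0, not_le.1 h5, h2, h3⟩
  have hle := Complex.arg_le_pi z
  have hlt := Complex.neg_pi_lt_arg z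
  rcases lt_or_ge 0 z.arg with h | h
  · exact key z.arg h (by linarith [pi_pos]) e0 e1
  · refine key (z.arg + 2 * π) (by linarith [pi_pos]) (by linarith) ?_ ?_
    · rwa [cos_add_two_pi]
    · rwa [sin_add_two_pi]

lemma angularDist_spec {β θ : ℝ} (hβ : β ∈ Set.Icc π (2 * π)) (h0 : 0 < θ) (h1 : θ < β) :
    ∃ C, 0 ≤ C ∧ C ^ 2 + angularDist β θ ^ 2 = 1 ∧ 0 < angularDist β θ ∧
      (∀ ω ∈ Set.Icc β (2 * π), cos (ω - θ) ≤ C) ∧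
      ∃ ω ∈ Set.Icc β (2 * π), C * cos (ω - θ) = C ^ 2 := by
  obtain ⟨hb1, hb2⟩ := hβ
  have hpi := pi_pos
  unfold angularDist
  split_ifs with h2 h3
  · refine ⟨cos θ, cos_nonneg_of_mem_Icc ⟨by linarith, h2⟩, by
      linear_combination sin_sq_add_cos_sq θ, sin_pos_of_pos_of_lt_pi h0 (by linarith),
      fun ω hω ↦ ?_, 2 * π, ⟨hb2, le_rfl⟩, by rw [cos_two_pi_sub]; ring⟩
    rw [← cos_two_pi_sub]
    rcases le_total (2 * π - (ω - θ)) π with h | h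
    · exact cos_le_cos_of_nonneg_of_le_pi h0.le h (by linarith [hω.2])
    · exact (cos_nonpos_of_pi_div_two_le_of_le (by linarith) (by linarith [hω.1])).trans
        (cos_nonneg_of_mem_Icc ⟨by linarith, h2⟩)
  · refine ⟨0, le_rfl, by norm_num, one_pos, fun ω hω ↦ ?_, β, ⟨le_rfl, hb2⟩, by ring⟩
    exact cos_nonpos_of_pi_div_two_le_of_le (by linarith [hω.1]) (by linarith [hω.2])
  · have hc : 0 ≤ cos (β - θ) := cos_nonneg_of_mem_Icc ⟨by linarith, by linarith⟩
    refine ⟨cos (β - θ), hc, by linear_combination sin_sq_add_cos_sq (β - θ),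
      sin_pos_of_pos_of_lt_pi (by linarith) (by linarith), fun ω hω ↦ ?_, β, ⟨le_rfl, hb2⟩, by ring⟩
    rcases le_total (ω - θ) π with h | h
    · exact cos_le_cos_of_nonneg_of_le_pi (by linarith) h (by linarith [hω.1])
    · exact (cos_nonpos_of_pi_div_two_le_of_le (by linarith) (by linarith [hω.2])).trans hc

lemma dist_logPolar_sq (t θ s ω : ℝ) :
    dist (logPolar t θ) !₂[s * cos ω, s * sin ω] ^ 2 =
      exp t ^ 2 + s ^ 2 - 2 * (exp t * s) * cos (ω - θ) := by
  rw [EuclideanSpace.dist_sq_eq, Fin.sum_univ_two]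
  simp only [logPolar, Real.dist_eq, sq_abs]
  simp
  rw [cos_sub]
  linear_combination exp t ^ 2 * sin_sq_add_cos_sq θ + s ^ 2 * sin_sq_add_cos_sq ω

lemma infDist_logPolar {β t θ : ℝ} (hβ : β ∈ Set.Icc π (2 * π)) (h0 : 0 < θ) (h1 : θ < β) :
    Metric.infDist (logPolar t θ) (sector β)ᶜ = exp t * angularDist β θ := by
  obtain ⟨C, hC, hCδ, hδ, hle, ω, hω, hωC⟩ := angularDist_spec hβ h0 h1
  have het := exp_pos t
  apply le_antisymm
  · refine (Metric.infDist_le_dist_of_mem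
      (notMem_sector hβ.2 (mul_nonneg het.le hC) hω)).trans ?_
    rw [← abs_of_nonneg (dist_nonneg (x := logPolar t θ)),
      ← abs_of_nonneg (mul_pos het hδ).le, ← sq_le_sq, dist_logPolar_sq]
    linear_combination -exp t ^ 2 * hCδ - 2 * exp t ^ 2 * hωC
  · refine (Metric.le_infDist ⟨_, notMem_sector hβ.2 le_rfl hω⟩).2 fun y hy ↦ ?_
    obtain ⟨s, η, hs, hη, rfl⟩ := exists_polar_of_notMem_sector hβ.2 hy
    rw [← abs_of_nonneg (dist_nonneg (x := logPolar t θ)),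
      ← abs_of_nonneg (mul_pos het hδ).le, ← sq_le_sq, dist_logPolar_sq]
    have h3 := mul_le_mul_of_nonneg_left (hle η hη) (mul_nonneg het.le hs)
    nlinarith [sq_nonneg (s - exp t * C), congrArg (fun x ↦ exp t ^ 2 * x) hCδ]

lemma integrable_norm_gradient_sq {u : EuclideanSpace ℝ (Fin 2) → ℝ}
    (hu : ContDiff ℝ (⊤ : ℕ∞) u) (hcs : HasCompactSupport u) :
    Integrable (fun x ↦ ‖gradient u x‖ ^ 2) := by
  have e : (fun x ↦ ‖gradient u x‖ ^ 2) = fun x ↦ ‖fderiv ℝ u x‖ ^ 2 := by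
    ext x; simp [gradient]
  rw [e]
  refine Continuous.integrable_of_hasCompactSupport
    ((hu.continuous_fderiv (by simp)).norm.pow 2) ?_
  exact (hcs.fderiv (𝕜 := ℝ)).comp_left (g := fun L ↦ ‖L‖ ^ 2) (by simp)

lemma integrable_sq_div_infDist_sq {β : ℝ} (hβ : β ∈ Set.Icc π (2 * π))
    {u : EuclideanSpace ℝ (Fin 2) → ℝ} (hu : Continuous u) (hcs : HasCompactSupport u)
    (hsub : tsupport u ⊆ sector β) :
    Integrable (fun x ↦ u x ^ 2 / Metric.infDist x (sector β)ᶜ ^ 2) := by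
  refine Continuous.integrable_of_hasCompactSupport (continuous_iff_continuousAt.2 fun x ↦ ?_) ?_
  · by_cases hx : x ∈ tsupport u
    · obtain ⟨t, θ, h0, h1, rfl⟩ := exists_logPolar_of_mem_sector (hsub hx)
      refine (hu.continuousAt.pow 2).div
        ((Metric.continuous_infDist_pt _).continuousAt.pow 2) (pow_ne_zero 2 ?_)
      rw [infDist_logPolar hβ h0 h1]
      obtain ⟨-, -, -, h, -⟩ := angularDist_spec hβ h0 h1
      positivity
    · refine (continuousAt_const (y := (0:ℝ))).congr ?_
      filter_upwards [notMem_tsupport_iff_eventuallyEq.1 hx] with y hy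
      simp [hy]
  · refine hcs.mono' fun x hx ↦ subset_tsupport u fun h ↦ hx ?_
    simp [h]

/-- The Dirichlet integral density in logarithmic polar coordinates. -/
noncomputable def logPolarEnergy (u : EuclideanSpace ℝ (Fin 2) → ℝ) (p : ℝ × ℝ) : ℝ :=
  deriv (fun t ↦ u (logPolar t p.2)) p.1 ^ 2 + deriv (fun θ ↦ u (logPolar p.1 θ)) p.2 ^ 2

lemma exp_sq_mul_norm_gradient_sq_eq_logPolarEnergy {u : EuclideanSpace ℝ (Fin 2) → ℝ}
    (hu : Differentiable ℝ u) (p : ℝ × ℝ) :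
    exp p.1 ^ 2 * ‖gradient u (logPolar p.1 p.2)‖ ^ 2 = logPolarEnergy u p :=
  exp_sq_mul_norm_gradient_sq (hu _)
    ((hu _).comp p.1 (hasDerivAt_logPolar_radial p.1 p.2).differentiableAt).hasDerivAt
    ((hu _).comp p.2 (hasDerivAt_logPolar_angular p.1 p.2).differentiableAt).hasDerivAt

lemma setIntegral_norm_gradient_sq {β : ℝ} (hβ : β ≤ 2 * π) {u : EuclideanSpace ℝ (Fin 2) → ℝ}
    (hu : ContDiff ℝ (⊤ : ℕ∞) u) (hcs : HasCompactSupport u) :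
    IntegrableOn (logPolarEnergy u) (Set.univ ×ˢ Set.Ioo 0 β) ∧
    ∫ x in sector β, ‖gradient u x‖ ^ 2 = ∫ p in Set.univ ×ˢ Set.Ioo 0 β, logPolarEnergy u p := by
  have hd := hu.differentiable (by simp)
  have h := integrableOn_sector hβ (integrable_norm_gradient_sq hu hcs)
  rw [setIntegral_sector hβ]
  simp only [exp_sq_mul_norm_gradient_sq_eq_logPolarEnergy hd] at h ⊢
  exact ⟨h, trivial⟩

lemma setIntegral_sq_div_infDist_sq {β : ℝ} (hβ : β ∈ Set.Icc π (2 * π))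
    {u : EuclideanSpace ℝ (Fin 2) → ℝ} (hu : Continuous u) (hcs : HasCompactSupport u)
    (hsub : tsupport u ⊆ sector β) :
    IntegrableOn (fun p : ℝ × ℝ ↦ u (logPolar p.1 p.2) ^ 2 / angularDist β p.2 ^ 2)
      (Set.univ ×ˢ Set.Ioo 0 β) ∧
    ∫ x in sector β, u x ^ 2 / Metric.infDist x (sector β)ᶜ ^ 2 =
      ∫ p in Set.univ ×ˢ Set.Ioo 0 β, u (logPolar p.1 p.2) ^ 2 / angularDist β p.2 ^ 2 := by
  have hS : MeasurableSet (Set.univ ×ˢ Set.Ioo 0 β : Set (ℝ × ℝ)) :=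
    MeasurableSet.univ.prod measurableSet_Ioo
  have e : Set.EqOn (fun p : ℝ × ℝ ↦ exp p.1 ^ 2 * (u (logPolar p.1 p.2) ^ 2 /
      Metric.infDist (logPolar p.1 p.2) (sector β)ᶜ ^ 2))
      (fun p ↦ u (logPolar p.1 p.2) ^ 2 / angularDist β p.2 ^ 2) (Set.univ ×ˢ Set.Ioo 0 β) := by
    rintro ⟨t, θ⟩ ⟨-, h0, h1⟩
    simp only at h0 h1 ⊢
    rw [infDist_logPolar hβ h0 h1, mul_pow, ← mul_div_assoc,
      mul_div_mul_left _ _ (pow_ne_zero 2 (exp_pos t).ne')]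
  have h := integrableOn_sector hβ.2 (integrable_sq_div_infDist_sq hβ hu hcs hsub)
  exact ⟨h.congr_fun e hS, by rw [setIntegral_sector hβ.2]; exact setIntegral_congr_fun hS e⟩

lemma contDiff_logPolar : ContDiff ℝ (⊤ : ℕ∞) (fun p : ℝ × ℝ ↦ logPolar p.1 p.2) := by
  refine contDiff_euclidean.2 fun i ↦ ?_
  fin_cases i
  · simp only [logPolar]; simp; fun_prop
  · simp only [logPolar]; simp; fun_prop

lemma exists_logPolar_eq_zero {β : ℝ} (hβ : β ∈ Set.Icc π (2 * π))
    {u : EuclideanSpace ℝ (Fin 2) → ℝ} (hsub : tsupport u ⊆ sector β) (t : ℝ) :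
    ∃ a, 0 < a ∧ a ≤ π / 2 ∧ (∀ θ ∈ Set.Icc 0 a, u (logPolar t θ) = 0) ∧
      ∀ θ ∈ Set.Icc (β - a) β, u (logPolar t θ) = 0 := by
  have hcont : Continuous (logPolar t) :=
    contDiff_logPolar.continuous.comp (continuous_const.prodMk continuous_id)
  have key : ∀ ω, logPolar t ω ∉ sector β → ∀ᶠ θ in nhds ω, u (logPolar t θ) = 0 := fun ω hω ↦ by
    have h := notMem_tsupport_iff_eventuallyEq.1 fun h ↦ hω (hsub h)
    exact (hcont.tendsto ω).eventually h
  have k0 := key 0 (by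
    have := notMem_sector hβ.2 (exp_pos t).le ⟨hβ.2, le_rfl⟩
    rw [cos_two_pi, sin_two_pi] at this
    rwa [logPolar, cos_zero, sin_zero])
  have k1 := key β (notMem_sector hβ.2 (exp_pos t).le ⟨le_rfl, hβ.2⟩)
  obtain ⟨a0, ha0, h0⟩ := Metric.eventually_nhds_iff.1 k0
  obtain ⟨a1, ha1, h1⟩ := Metric.eventually_nhds_iff.1 k1
  have hpi := pi_pos
  have hm : 0 < min a0 a1 := lt_min ha0 ha1
  refine ⟨min (π / 2) (min a0 a1 / 2), lt_min (by positivity) (by positivity), min_le_left _ _,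
    fun θ hθ ↦ h0 ?_, fun θ hθ ↦ h1 ?_⟩
  · rw [Real.dist_eq, sub_zero, abs_of_nonneg hθ.1]
    linarith [hθ.2.trans (min_le_right _ _), min_le_left a0 a1]
  · rw [Real.dist_eq, abs_lt]
    have := min_le_right (π / 2) (min a0 a1 / 2)
    constructor <;> linarith [hθ.1, hθ.2, min_le_right a0 a1]

lemma hardy_sector {α β κ : ℝ} (h0 : 1 / 2 ≤ α) (h1 : α ≤ 1)
    (hβ : β ∈ Set.Icc π (2 * π)) (hκ0 : 0 ≤ κ) (hκ1 : κ < 1) (hκ : κ ^ 2 = α * (1 - α))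
    (hR : κ * tan (κ * (β - π) / 2) = gammaSlope α) {u : EuclideanSpace ℝ (Fin 2) → ℝ}
    (hu : ContDiff ℝ (⊤ : ℕ∞) u) (hcs : HasCompactSupport u) (hsub : tsupport u ⊆ sector β) :
    κ ^ 2 * ∫ x in sector β, u x ^ 2 / Metric.infDist x (sector β)ᶜ ^ 2 ≤
      ∫ x in sector β, ‖gradient u x‖ ^ 2 := by
  have hpi := pi_pos
  have hb : 0 ≤ β := by linarith [hβ.1]
  obtain ⟨i1, e1⟩ := setIntegral_norm_gradient_sq hβ.2 hu hcs
  obtain ⟨i2, e2⟩ := setIntegral_sq_div_infDist_sq hβ hu.continuous hcs hsub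
  rw [e1, e2]
  rw [Measure.volume_eq_prod] at i1 i2 ⊢
  rw [setIntegral_prod _ i1, setIntegral_prod _ i2, ← integral_const_mul]
  rw [IntegrableOn, ← Measure.prod_restrict] at i1 i2
  refine integral_mono_ae (i2.integral_prod_left.const_mul _) i1.integral_prod_left ?_
  filter_upwards [i1.prod_right_ae] with t ht
  have hs : ContDiff ℝ (⊤ : ℕ∞) (fun θ ↦ u (logPolar t θ)) :=
    hu.comp (contDiff_logPolar.comp (contDiff_const.prodMk contDiff_id))
  have hs' : Continuous (deriv fun θ ↦ u (logPolar t θ)) := hs.continuous_deriv (by simp)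
  obtain ⟨a, ha, ha', z0, z1⟩ := exists_logPolar_eq_zero hβ hsub t
  have key := hardy_angular h0 h1 hβ hκ0 hκ1 hκ hR ha ha'
    (fun x ↦ (hs.differentiable (by simp) x).hasDerivAt) hs' z0 z1
  rw [intervalIntegral.integral_of_le hb, intervalIntegral.integral_of_le hb,
    integral_Ioc_eq_integral_Ioo, integral_Ioc_eq_integral_Ioo] at key
  refine key.trans (integral_mono ?_ ht fun θ ↦ ?_)
  · exact ((hs'.pow 2).continuousOn.integrableOn_Icc (a := 0) (b := β)).mono_set
      Set.Ioo_subset_Icc_self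
  · simp only [logPolarEnergy]
    linarith [sq_nonneg (deriv (fun t ↦ u (logPolar t θ)) t)]

/-- The function on the plane equal to `φ θ * η t` at the point with logarithmic polar
coordinates `(t, θ)`, where `θ ∈ (0, 2π]`. -/
noncomputable def ofLogPolar (φ η : ℝ → ℝ) (x : EuclideanSpace ℝ (Fin 2)) : ℝ :=
  φ (π + (Complex.log (-((x 0 : ℂ) + x 1 * Complex.I))).im) *
    η (Complex.log (-((x 0 : ℂ) + x 1 * Complex.I))).re

lemma log_neg_logPolar {t θ : ℝ} (h0 : 0 < θ) (h1 : θ ≤ 2 * π) :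
    Complex.log (-((logPolar t θ 0 : ℂ) + logPolar t θ 1 * Complex.I)) =
      (t : ℂ) + ((θ - π : ℝ) : ℂ) * Complex.I := by
  have h : -((logPolar t θ 0 : ℂ) + logPolar t θ 1 * Complex.I) =
      Complex.exp ((t : ℂ) + ((θ - π : ℝ) : ℂ) * Complex.I) := by
    rw [Complex.exp_add, Complex.exp_mul_I, ← Complex.ofReal_cos, ← Complex.ofReal_sin,
      cos_sub_pi, sin_sub_pi, ← Complex.ofReal_exp]
    simp [logPolar]
    ring
  rw [h, Complex.log_exp]
  · simp; linarith
  · simp; linarith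

lemma ofLogPolar_logPolar (φ η : ℝ → ℝ) {t θ : ℝ} (h0 : 0 < θ) (h1 : θ ≤ 2 * π) :
    ofLogPolar φ η (logPolar t θ) = φ θ * η t := by
  rw [ofLogPolar, log_neg_logPolar h0 h1]
  simp

lemma ofLogPolar_eq_zero {φ η : ℝ → ℝ} {β : ℝ} (hβ : β ∈ Set.Icc π (2 * π))
    (hφ : ∀ θ, β ≤ θ → φ θ = 0) (hη : η 0 = 0) {x : EuclideanSpace ℝ (Fin 2)}
    (hx : x ∉ sector β) : ofLogPolar φ η x = 0 := by
  obtain ⟨s, ω, hs, hω, rfl⟩ := exists_polar_of_notMem_sector hβ.2 hx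
  rcases hs.eq_or_lt with rfl | hs
  · simp [ofLogPolar, hη]
  · have : (!₂[s * cos ω, s * sin ω] : EuclideanSpace ℝ (Fin 2)) = logPolar (log s) ω := by
      rw [logPolar, exp_log hs]
    rw [this, ofLogPolar_logPolar φ η (by linarith [pi_pos, hβ.1, hω.1]) hω.2, hφ ω hω.1, zero_mul]

lemma ofLogPolar_spec {φ η : ℝ → ℝ} {β a : ℝ} (hβ : β ∈ Set.Icc π (2 * π)) (ha : 0 < a)
    (hφ : ContDiff ℝ (⊤ : ℕ∞) φ) (hφ0 : ∀ θ, θ ≤ a → φ θ = 0) (hφ1 : ∀ θ, β - a ≤ θ → φ θ = 0)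
    (hη : ContDiff ℝ (⊤ : ℕ∞) η) (hηc : HasCompactSupport η) (hη0 : η 0 = 0) :
    ContDiff ℝ (⊤ : ℕ∞) (ofLogPolar φ η) ∧ HasCompactSupport (ofLogPolar φ η) ∧
      tsupport (ofLogPolar φ η) ⊆ sector β := by
  set K : Set (EuclideanSpace ℝ (Fin 2)) :=
    (fun p : ℝ × ℝ ↦ logPolar p.1 p.2) '' (tsupport η ×ˢ Set.Icc a (β - a)) with hK
  have hKc : IsCompact K := (IsCompact.prod hηc isCompact_Icc).image contDiff_logPolar.continuous
  have hz : ∀ x, x ∉ K → ofLogPolar φ η x = 0 := by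
    intro x hx
    by_cases hxs : x ∈ sector β
    · obtain ⟨t, θ, h0, h1, rfl⟩ := exists_logPolar_of_mem_sector hxs
      rw [ofLogPolar_logPolar φ η h0 (by linarith [hβ.2])]
      by_contra hne
      refine hx ⟨(t, θ), ⟨subset_tsupport η (right_ne_zero_of_mul hne), ?_, ?_⟩, rfl⟩
      · by_contra h
        exact left_ne_zero_of_mul hne (hφ0 θ (not_le.1 h).le)
      · by_contra h
        exact left_ne_zero_of_mul hne (hφ1 θ (not_le.1 h).le)
    · exact ofLogPolar_eq_zero hβ (fun θ h ↦ hφ1 θ (by linarith)) hη0 hxs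
  have hts : tsupport (ofLogPolar φ η) ⊆ K :=
    closure_minimal (fun x hx ↦ by_contra fun h ↦ hx (hz x h)) hKc.isClosed
  refine ⟨contDiff_iff_contDiffAt.2 fun x ↦ ?_, HasCompactSupport.intro hKc hz, hts.trans ?_⟩
  · by_cases hx : x ∈ K
    · obtain ⟨⟨t, θ⟩, ⟨-, h0, h1⟩, rfl⟩ := hx
      simp only at h0 h1
      have hlin : ContDiff ℝ (⊤ : ℕ∞)
          (fun x : EuclideanSpace ℝ (Fin 2) ↦ -((x 0 : ℂ) + x 1 * Complex.I)) := by
        have c0 : ∀ i, ContDiff ℝ (⊤ : ℕ∞) (fun x : EuclideanSpace ℝ (Fin 2) ↦ (x i : ℂ)) :=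
          fun i ↦ Complex.ofRealCLM.contDiff.comp (contDiff_euclidean.1 contDiff_id i)
        exact ((c0 0).add ((c0 1).mul contDiff_const)).neg
      have hslit : -((logPolar t θ 0 : ℂ) + logPolar t θ 1 * Complex.I) ∈ Complex.slitPlane := by
        refine Complex.mem_slitPlane_iff_arg.2 ⟨?_, ?_⟩
        · rw [← Complex.log_im, log_neg_logPolar (by linarith) (by linarith [hβ.2])]
          simp; linarith [hβ.2]
        · intro h
          have e1 : logPolar t θ 0 = exp t * cos θ := by simp [logPolar]
          have e2 : logPolar t θ 1 = exp t * sin θ := by simp [logPolar]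
          have e3 := congrArg Complex.re h
          have e4 := congrArg Complex.im h
          simp [e1, e2, -Complex.ofReal_mul] at e3 e4
          have := sin_sq_add_cos_sq θ
          simp [e3, e4] at this
      have hlog : ContDiffAt ℝ (⊤ : ℕ∞) (fun x : EuclideanSpace ℝ (Fin 2) ↦
          Complex.log (-((x 0 : ℂ) + x 1 * Complex.I))) (logPolar t θ) :=
        ContDiffAt.comp (g := Complex.log) (logPolar t θ)
          ((Complex.contDiffAt_log hslit).restrict_scalars ℝ) hlin.contDiffAt
      refine (hφ.contDiffAt.comp _ (contDiffAt_const.add ?_)).mul (hη.contDiffAt.comp _ ?_)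
      · exact Complex.imCLM.contDiff.contDiffAt.comp _ hlog
      · exact Complex.reCLM.contDiff.contDiffAt.comp _ hlog
    · refine (contDiffAt_const (c := (0:ℝ))).congr_of_eventuallyEq ?_
      filter_upwards [hKc.isClosed.isOpen_compl.mem_nhds hx] with y hy
      exact hz y hy
  · rintro _ ⟨⟨t, θ⟩, ⟨-, h0, h1⟩, rfl⟩
    simp only at h0 h1
    exact logPolar_mem_sector (by linarith) (by linarith)

lemma logPolarEnergy_ofLogPolar {φ η : ℝ → ℝ} (hφ : Differentiable ℝ φ) (hη : Differentiable ℝ η)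
    {β : ℝ} (hβ : β ≤ 2 * π) {p : ℝ × ℝ} (hp : p ∈ Set.univ ×ˢ Set.Ioo 0 β) :
    logPolarEnergy (ofLogPolar φ η) p =
      deriv η p.1 ^ 2 * φ p.2 ^ 2 + η p.1 ^ 2 * deriv φ p.2 ^ 2 := by
  obtain ⟨t, θ⟩ := p
  obtain ⟨-, h0, h1⟩ := hp
  simp only at h0 h1
  have e1 : (fun s ↦ ofLogPolar φ η (logPolar s θ)) = fun s ↦ φ θ * η s :=
    funext fun s ↦ ofLogPolar_logPolar φ η h0 (h1.le.trans hβ)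
  have e2 : (fun ω ↦ ofLogPolar φ η (logPolar t ω)) =ᶠ[nhds θ] fun ω ↦ φ ω * η t := by
    filter_upwards [Ioo_mem_nhds h0 h1] with ω hω
    exact ofLogPolar_logPolar φ η hω.1 (hω.2.le.trans hβ)
  simp only [logPolarEnergy]
  rw [e1, e2.deriv_eq, deriv_const_mul _ (hη t), deriv_mul_const (hφ θ)]
  ring

lemma angular_inequality_of_hardy_separated {φ η : ℝ → ℝ} {β a c : ℝ}
    (hβ : β ∈ Set.Icc π (2 * π))
    (hc : ∀ u : EuclideanSpace ℝ (Fin 2) → ℝ, ContDiff ℝ (⊤ : ℕ∞) u → HasCompactSupport u →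
      tsupport u ⊆ sector β →
      c * ∫ x in sector β, u x ^ 2 / Metric.infDist x (sector β)ᶜ ^ 2 ≤
        ∫ x in sector β, ‖gradient u x‖ ^ 2) (ha : 0 < a)
    (hφ : ContDiff ℝ (⊤ : ℕ∞) φ) (hφ0 : ∀ θ, θ ≤ a → φ θ = 0) (hφ1 : ∀ θ, β - a ≤ θ → φ θ = 0)
    (hη : ContDiff ℝ (⊤ : ℕ∞) η) (hηc : HasCompactSupport η) (hη0 : η 0 = 0) :
    c * ((∫ t, η t ^ 2) * ∫ θ in 0..β, φ θ ^ 2 / angularDist β θ ^ 2) ≤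
      (∫ t, deriv η t ^ 2) * (∫ θ in 0..β, φ θ ^ 2) +
        (∫ t, η t ^ 2) * ∫ θ in 0..β, deriv φ θ ^ 2 := by
  have hpi := pi_pos
  have hb : 0 ≤ β := by linarith [hβ.1]
  obtain ⟨s1, s2, s3⟩ := ofLogPolar_spec hβ ha hφ hφ0 hφ1 hη hηc hη0
  have hφ' : Continuous (deriv φ) := hφ.continuous_deriv (by simp)
  have hη' : Continuous (deriv η) := hη.continuous_deriv (by simp)
  have h := hc _ s1 s2 s3
  have hS : MeasurableSet (Set.univ ×ˢ Set.Ioo 0 β : Set (ℝ × ℝ)) :=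
    MeasurableSet.univ.prod measurableSet_Ioo
  have q1 : ∀ f : ℝ → ℝ, HasCompactSupport f → HasCompactSupport (fun t ↦ f t ^ 2) := fun f hf ↦
    hf.comp_left (g := fun x : ℝ ↦ x ^ 2) (by simp)
  have j1 : Integrable (fun t ↦ η t ^ 2) (volume.restrict Set.univ) := by
    rw [Measure.restrict_univ]
    exact (hη.continuous.pow 2).integrable_of_hasCompactSupport (q1 _ hηc)
  have j2 : Integrable (fun t ↦ deriv η t ^ 2) (volume.restrict Set.univ) := by
    rw [Measure.restrict_univ]
    exact (hη'.pow 2).integrable_of_hasCompactSupport (q1 _ hηc.deriv)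
  have j3 : Integrable (fun θ ↦ φ θ ^ 2) (volume.restrict (Set.Ioo 0 β)) :=
    ((hφ.continuous.pow 2).continuousOn.integrableOn_Icc (a := 0) (b := β)).mono_set
      Set.Ioo_subset_Icc_self
  have j4 : Integrable (fun θ ↦ deriv φ θ ^ 2) (volume.restrict (Set.Ioo 0 β)) :=
    ((hφ'.pow 2).continuousOn.integrableOn_Icc (a := 0) (b := β)).mono_set
      Set.Ioo_subset_Icc_self
  rw [(setIntegral_norm_gradient_sq hβ.2 s1 s2).2,
    (setIntegral_sq_div_infDist_sq hβ s1.continuous s2 s3).2,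
    setIntegral_congr_fun hS (g := fun p ↦ η p.1 ^ 2 * (φ p.2 ^ 2 / angularDist β p.2 ^ 2)) (by
      rintro ⟨t, θ⟩ ⟨-, h0, h1⟩
      simp only at h0 h1 ⊢
      rw [ofLogPolar_logPolar φ η h0 (h1.le.trans hβ.2)]
      ring),
    setIntegral_congr_fun hS fun p hp ↦ logPolarEnergy_ofLogPolar
      (hφ.differentiable (by simp)) (hη.differentiable (by simp)) hβ.2 hp] at h
  rw [Measure.volume_eq_prod, setIntegral_prod_mul (fun t ↦ η t ^ 2)
      (fun θ ↦ φ θ ^ 2 / angularDist β θ ^ 2),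
    integral_add (by rw [← Measure.prod_restrict]; exact j2.mul_prod j3)
      (by rw [← Measure.prod_restrict]; exact j1.mul_prod j4),
    setIntegral_prod_mul (fun t ↦ deriv η t ^ 2) (fun θ ↦ φ θ ^ 2),
    setIntegral_prod_mul (fun t ↦ η t ^ 2) (fun θ ↦ deriv φ θ ^ 2), Measure.restrict_univ] at h
  simpa only [intervalIntegral.integral_of_le hb, integral_Ioc_eq_integral_Ioo] using h

lemma angular_inequality_of_hardy {φ : ℝ → ℝ} {β a c : ℝ} (hβ : β ∈ Set.Icc π (2 * π))
    (hc : ∀ u : EuclideanSpace ℝ (Fin 2) → ℝ, ContDiff ℝ (⊤ : ℕ∞) u → HasCompactSupport u →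
      tsupport u ⊆ sector β →
      c * ∫ x in sector β, u x ^ 2 / Metric.infDist x (sector β)ᶜ ^ 2 ≤
        ∫ x in sector β, ‖gradient u x‖ ^ 2) (ha : 0 < a)
    (hφ : ContDiff ℝ (⊤ : ℕ∞) φ) (hφ0 : ∀ θ, θ ≤ a → φ θ = 0)
    (hφ1 : ∀ θ, β - a ≤ θ → φ θ = 0) :
    c * (∫ θ in 0..β, φ θ ^ 2 / angularDist β θ ^ 2) ≤ ∫ θ in 0..β, deriv φ θ ^ 2 := by
  let η : ContDiffBump (2 : ℝ) := ⟨1 / 2, 1, by norm_num, by norm_num⟩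
  have hη0 : η 0 = 0 := η.zero_of_le_dist (by simp [η, Real.dist_eq])
  have hη2 : η 2 = 1 := η.one_of_mem_closedBall (Metric.mem_closedBall_self (by norm_num [η]))
  have hηs : ContDiff ℝ (⊤ : ℕ∞) η := η.contDiff
  have hηd : Differentiable ℝ η := hηs.differentiable (by simp)
  set B := ∫ t, η t ^ 2 with hB
  set A := ∫ t, deriv η t ^ 2
  set X := ∫ θ in 0..β, φ θ ^ 2 / angularDist β θ ^ 2
  set Y := ∫ θ in 0..β, φ θ ^ 2
  set Z := ∫ θ in 0..β, deriv φ θ ^ 2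
  have hBpos : 0 < B := by
    refine (hηs.continuous.pow 2).integral_pos_of_hasCompactSupport_nonneg_nonzero
      (η.hasCompactSupport.comp_left (g := fun x : ℝ ↦ x ^ 2) (by simp))
      (fun t ↦ sq_nonneg _) (x := 2) ?_
    simp [hη2]
  have key : ∀ n : ℕ, c * X ≤ (1 / ((n : ℝ) + 1)) ^ 2 * (A * Y / B) + Z := by
    intro n
    set s : ℝ := 1 / ((n : ℝ) + 1) with hs
    have hspos : 0 < s := by positivity
    have h := angular_inequality_of_hardy_separated (η := fun t ↦ η (s * t)) hβ hc ha hφ hφ0 hφ1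
      (hηs.comp (contDiff_const.mul contDiff_id))
      (η.hasCompactSupport.comp_homeomorph (Homeomorph.mulLeft₀ s hspos.ne')) (by simpa using hη0)
    have e1 : deriv (fun t ↦ η (s * t)) = fun t ↦ s * deriv η (s * t) := by
      ext t
      exact deriv_comp_mul_left s η t
    simp only [e1, mul_pow] at h
    rw [integral_const_mul, Measure.integral_comp_mul_left (fun t ↦ η t ^ 2) s,
      Measure.integral_comp_mul_left (fun t ↦ deriv η t ^ 2) s,
      abs_of_pos (inv_pos.2 hspos)] at h
    simp only [smul_eq_mul] at h
    have h2 : s⁻¹ * B * (c * X) ≤ s⁻¹ * B * (s ^ 2 * (A * Y / B) + Z) := by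
      calc _ = c * (s⁻¹ * B * X) := by ring
        _ ≤ s ^ 2 * (s⁻¹ * A) * Y + s⁻¹ * B * Z := h
        _ = _ := by field_simp
    exact le_of_mul_le_mul_left h2 (by positivity)
  have hlim : Filter.Tendsto (fun n : ℕ ↦ (1 / ((n : ℝ) + 1)) ^ 2 * (A * Y / B) + Z) Filter.atTop
      (nhds Z) := by
    simpa using ((tendsto_one_div_add_atTop_nhds_zero_nat (𝕜 := ℝ)).pow 2).mul_const (A * Y / B)
      |>.add_const Z
  exact ge_of_tendsto' hlim key

lemma hardyConst_sector_of_sectorEquation {β c : ℝ} (hβ : β ∈ Set.Icc π (2 * π))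
    (hc : c ∈ Set.Ioc (0 : ℝ) (1 / 4)) (h : sectorEquation β c) : hardyConst (sector β) = c := by
  obtain ⟨hc0, hc1⟩ := hc
  have hs0 := Real.sqrt_nonneg (1 - 4 * c)
  have hs2 : √(1 - 4 * c) ^ 2 = 1 - 4 * c := Real.sq_sqrt (by linarith)
  have hk0 := Real.sqrt_nonneg c
  have hk2 : √c ^ 2 = c := Real.sq_sqrt hc0.le
  have hα0 : 1 / 2 ≤ (1 + √(1 - 4 * c)) / 2 := by linarith
  have hα1 : (1 + √(1 - 4 * c)) / 2 ≤ 1 := by nlinarith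
  have hκ1 : √c < 1 := by nlinarith
  have hκ : √c ^ 2 = (1 + √(1 - 4 * c)) / 2 * (1 - (1 + √(1 - 4 * c)) / 2) := by
    rw [hk2]; linear_combination hs2 / 4
  have hR : √c * tan (√c * (β - π) / 2) = gammaSlope ((1 + √(1 - 4 * c)) / 2) := by
    refine h.trans ?_
    rw [gammaSlope]
    congr 4 <;> ring_nf
  refine IsGreatest.csSup_eq ⟨⟨hc0.le, fun u hu hcs hsub ↦ ?_⟩, fun c' ⟨_, hc'⟩ ↦ ?_⟩
  · have := hardy_sector hα0 hα1 hβ hk0 hκ1 hκ hR hu hcs hsub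
    rwa [hk2] at this
  · by_contra! hlt
    obtain ⟨a, φ, φ', ha, ha', hd, hcont, h0, h1, hφc⟩ :=
      exists_angular_test_function hα0 hα1 hβ hk0 hκ1 hκ hR (hk2.trans_lt hlt)
    exact hφc.not_ge (angular_inequality_of_smooth ha ha'
      (fun ψ hψ hψ0 hψ1 ↦ angular_inequality_of_hardy hβ hc' ha hψ hψ0 hψ1) hd hcont h0 h1)

lemma exists_sectorEquation {β : ℝ}
    (hβ : β ∈ Set.Icc (π + 4 * arctan (2 * gammaSlope (1 / 2))) (2 * π)) :
    ∃ c ∈ Set.Ioc (0 : ℝ) (1 / 4), sectorEquation β c := by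
  have hg := gammaSlope_pos (α := 1 / 2) (by norm_num)
  have hat : 0 < arctan (2 * gammaSlope (1 / 2)) := arctan_pos.2 (by positivity)
  have hpi := pi_pos
  obtain ⟨hβ0, hβ1⟩ := hβ
  have harg : ∀ c ∈ Set.Icc (0 : ℝ) (1 / 4), √c * (β - π) / 2 ∈ Set.Ioo (-(π / 2)) (π / 2) := by
    intro c hc
    have h1 : √c ≤ 1 / 2 := Real.sqrt_le_iff.2 ⟨by norm_num, by linarith [hc.2]⟩
    have h0 := Real.sqrt_nonneg c
    constructor <;> nlinarith
  have hGamma : ∀ {f : ℝ → ℝ}, Continuous f → (∀ x, 0 < f x) → Continuous fun x ↦ Gamma (f x) :=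
    fun hf hpos ↦ continuous_iff_continuousAt.2 fun x ↦
      (differentiableAt_Gamma fun m ↦ by
        have := hpos x
        have := Nat.cast_nonneg (α := ℝ) m
        linarith).continuousAt.comp hf.continuousAt
  have hpos3 : ∀ c : ℝ, 0 < (3 + √(1 - 4 * c)) / 4 := fun c ↦ by positivity
  have hpos1 : ∀ c : ℝ, 0 < (1 + √(1 - 4 * c)) / 4 := fun c ↦ by positivity
  have hR : Continuous fun c : ℝ ↦
      2 * (Gamma ((3 + √(1 - 4 * c)) / 4) / Gamma ((1 + √(1 - 4 * c)) / 4)) ^ 2 :=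
    continuous_const.mul (((hGamma (by fun_prop) hpos3).div (hGamma (by fun_prop) hpos1)
      fun c ↦ (Gamma_pos_of_pos (hpos1 c)).ne').pow 2)
  have hL : ContinuousOn (fun c : ℝ ↦ √c * tan (√c * (β - π) / 2)) (Set.Icc 0 (1 / 4)) :=
    (Real.continuous_sqrt.continuousOn).mul
      (continuousOn_tan_Ioo.comp (by fun_prop) fun c hc ↦ harg c hc)
  have hend : 2 * (Gamma ((3 + √(1 - 4 * (1 / 4))) / 4) / Gamma ((1 + √(1 - 4 * (1 / 4))) / 4)) ^ 2
      = gammaSlope (1 / 2) := by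
    rw [gammaSlope]; norm_num
  have h2 : √(1 / 4 : ℝ) = 1 / 2 := by
    rw [show (1 / 4 : ℝ) = (1 / 2) ^ 2 by norm_num, Real.sqrt_sq (by norm_num)]
  have hright : (fun c : ℝ ↦ √c * tan (√c * (β - π) / 2) -
      2 * (Gamma ((3 + √(1 - 4 * c)) / 4) / Gamma ((1 + √(1 - 4 * c)) / 4)) ^ 2) (1 / 4) ≥ 0 := by
    have hle : 2 * gammaSlope (1 / 2) ≤ tan (√(1 / 4) * (β - π) / 2) := by
      rw [← tan_arctan (2 * gammaSlope (1 / 2))]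
      refine strictMonoOn_tan.monotoneOn (arctan_mem_Ioo _) (harg _ (by norm_num)) ?_
      rw [h2]; linarith
    simp only [hend]
    rw [h2] at hle ⊢
    linarith
  have hleft : (fun c : ℝ ↦ √c * tan (√c * (β - π) / 2) -
      2 * (Gamma ((3 + √(1 - 4 * c)) / 4) / Gamma ((1 + √(1 - 4 * c)) / 4)) ^ 2) 0 < 0 := by
    have h3 := Gamma_pos_of_pos (hpos3 0)
    have h1 := Gamma_pos_of_pos (hpos1 0)
    simp only [Real.sqrt_zero, zero_mul, zero_sub, neg_lt_zero]
    positivity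
  obtain ⟨c, hc, hroot⟩ := intermediate_value_Icc (by norm_num) (hL.sub hR.continuousOn)
    ⟨hleft.le, hright⟩
  refine ⟨c, ⟨lt_of_le_of_ne hc.1 ?_, hc.2⟩, sub_eq_zero.1 hroot⟩
  rintro rfl
  exact hleft.ne hroot

lemma sectorEquation_quarter :
    sectorEquation (π + 4 * arctan (2 * gammaSlope (1 / 2))) (1 / 4) := by
  have h2 : √(1 / 4 : ℝ) = 1 / 2 := by
    rw [show (1 / 4 : ℝ) = (1 / 2) ^ 2 by norm_num, Real.sqrt_sq (by norm_num)]
  rw [sectorEquation, h2, show (1 / 2 : ℝ) * (π + 4 * arctan (2 * gammaSlope (1 / 2)) - π) / 2 =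
    arctan (2 * gammaSlope (1 / 2)) by ring, tan_arctan, gammaSlope]
  norm_num
  ring

/-- **The Hardy constant of wide sectors via the Gamma function (Barbatis–Tertikas).**
Let `β_cr = sup{β ∈ [π, 2π] : H(Λ_β) = 1/4}` be the critical angle. For every
`β ∈ [β_cr, 2π]`, the Hardy constant `c_β = H(Λ_β)` is the unique solution
`c ∈ (0, 1/4]` of `√c tan(√c (β − π)/2) = 2 (Γ((3+√(1−4c))/4) / Γ((1+√(1−4c))/4))²`. -/
theorem hardy_constant_sector_equation
    (βcr : ℝ)
    (hdef : βcr = sSup {β : ℝ | β ∈ Set.Icc Real.pi (2 * Real.pi) ∧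
      hardyConst (sector β) = 1 / 4})
    (β : ℝ) (hβ : β ∈ Set.Icc βcr (2 * Real.pi)) :
    hardyConst (sector β) ∈ Set.Ioc (0 : ℝ) (1 / 4) ∧
    sectorEquation β (hardyConst (sector β)) ∧
    ∀ c ∈ Set.Ioc (0 : ℝ) (1 / 4), sectorEquation β c → c = hardyConst (sector β) := by
  have hg := gammaSlope_pos (α := 1 / 2) (by norm_num)
  have hat : 0 < arctan (2 * gammaSlope (1 / 2)) := arctan_pos.2 (by positivity)
  have hat' : arctan (2 * gammaSlope (1 / 2)) ≤ π / 4 := by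
    rw [← arctan_one]
    exact arctan_strictMono.monotone (by linarith [gammaSlope_half_le])
  have hmem : π + 4 * arctan (2 * gammaSlope (1 / 2)) ∈ Set.Icc π (2 * π) :=
    ⟨by linarith, by linarith⟩
  have hcr : π + 4 * arctan (2 * gammaSlope (1 / 2)) ≤ βcr := by
    rw [hdef]
    exact le_csSup ⟨2 * π, fun x hx ↦ hx.1.2⟩
      ⟨hmem, hardyConst_sector_of_sectorEquation hmem (by norm_num) sectorEquation_quarter⟩
  have hβ' : β ∈ Set.Icc π (2 * π) := ⟨hmem.1.trans (hcr.trans hβ.1), hβ.2⟩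
  obtain ⟨c, hc, hceq⟩ := exists_sectorEquation ⟨hcr.trans hβ.1, hβ.2⟩
  rw [hardyConst_sector_of_sectorEquation hβ' hc hceq]
  exact ⟨hc, hceq, fun c' hc' h' ↦ (hardyConst_sector_of_sectorEquation hβ' hc' h').symm.trans
    (hardyConst_sector_of_sectorEquation hβ' hc hceq)⟩
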